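/- arXiv:0904.4081 — 7 statements merged into one kernel-verified Lean document; each statement's English description precedes it below -/
import Mathlib

section
/- Let g : ℂ → ℂ be an entire function. If there exist homeomorphisms φ, ψ : ℂ → ℂ such that φ(sin z) = g(ψ(z)) for all z ∈ ℂ, then there exist constants a, b, c, d ∈ ℂ with a·b ≠ 0 such that g(z) = a·sin(b·z + c) + d for all z ∈ ℂ. -/
open Complex

open Filter Topology

/-- A continuous injective lift of an entire function through a nonconstant entire function
is entire. -/
theorem differentiable_of_comp_eq {g γ h : ℂ → ℂ} (hg : Differentiable ℂ g)
    (hg' : deriv g ≠ 0) (hh : Differentiable ℂ h) (hγ : Continuous γ)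
    (hinj : Function.Injective γ) (hcomp : ∀ z, g (γ z) = h z) : Differentiable ℂ γ := by
  have hregular : ∀ z, deriv g (γ z) ≠ 0 → DifferentiableAt ℂ γ z := by
    intro z hz
    have hs : HasStrictDerivAt g (deriv g (γ z)) (γ z) := (hg.analyticAt _).hasStrictDerivAt
    have he := hs.to_localInverse hz
    have hl := hγ.continuousAt.eventually (hs.eventually_left_inverse hz)
    rw [hcomp] at he
    refine (he.hasDerivAt.differentiableAt.comp z (hh z)).congr_of_eventuallyEq ?_
    filter_upwards [hl] with y hy
    rw [Function.comp_apply, ← hcomp, hy]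
  have hd : AnalyticOnNhd ℂ (deriv g) Set.univ := fun z _ => (hg.analyticAt z).deriv
  intro z
  have hne : ∀ᶠ w in 𝓝[≠] (γ z), deriv g w ≠ 0 := by
    refine (hd (γ z) trivial).eventually_eq_zero_or_eventually_ne_zero.resolve_left fun h0 => ?_
    exact hg' (hd.eq_of_eventuallyEq (fun _ _ => analyticAt_const) h0)
  have ht : Tendsto γ (𝓝[≠] z) (𝓝[≠] (γ z)) :=
    tendsto_nhdsWithin_of_tendsto_nhds_of_eventually_within _
      (hγ.continuousAt.tendsto.mono_left nhdsWithin_le_nhds)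
      (eventually_mem_nhdsWithin.mono fun y hy => hinj.ne hy)
  exact (analyticAt_of_differentiable_on_punctured_nhds_of_continuousAt
    ((ht.eventually hne).mono hregular) hγ.continuousAt).differentiableAt

/-- A nonconstant entire function has a derivative that is not identically zero. -/
theorem deriv_ne_zero_of_apply_ne {g : ℂ → ℂ} (hg : Differentiable ℂ g) {x y : ℂ}
    (hxy : g x ≠ g y) : deriv g ≠ 0 := fun h0 =>
  hxy (is_const_of_deriv_eq_zero hg (congrFun h0) x y)

theorem Homeomorph.differentiable_symm_of_differentiable (f : ℂ ≃ₜ ℂ) (hf : Differentiable ℂ f) :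
    Differentiable ℂ f.symm :=
  differentiable_of_comp_eq hf (deriv_ne_zero_of_apply_ne hf (f.injective.ne zero_ne_one))
    differentiable_id f.symm.continuous f.symm.injective fun z => f.apply_symm_apply z

theorem Homeomorph.deriv_ne_zero_of_differentiable (f : ℂ ≃ₜ ℂ) (hf : Differentiable ℂ f)
    (z : ℂ) : deriv f z ≠ 0 := by
  intro h0
  have h1 := ((f.differentiable_symm_of_differentiable hf) (f z)).hasDerivAt.comp z
    (hf z).hasDerivAt
  have h2 : (f.symm ∘ f : ℂ → ℂ) = id := funext fun z => f.symm_apply_apply z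
  rw [h2, h0, mul_zero] at h1
  exact zero_ne_one (h1.unique (hasDerivAt_id z))

theorem Homeomorph.continuous_inv_comp_inv (f : ℂ ≃ₜ ℂ) (h0 : f 0 = 0) :
    Continuous fun w => (f w⁻¹)⁻¹ := by
  rw [continuous_iff_continuousAt]
  intro w
  by_cases hw : w = 0
  · subst hw
    have hc : ContinuousWithinAt (fun w => (f w⁻¹)⁻¹) {0}ᶜ 0 := by
      have h1 : Tendsto f (Bornology.cobounded ℂ) (Bornology.cobounded ℂ) := by
        simpa [← Metric.cobounded_eq_cocompact] using f.isClosedEmbedding.tendsto_cocompact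
      have h2 := (tendsto_inv₀_cobounded.comp h1).comp (tendsto_inv₀_nhdsNE_zero (α := ℂ))
      simpa [ContinuousWithinAt, h0, Function.comp_def] using h2
    exact continuousWithinAt_compl_self.1 hc
  · refine ContinuousAt.inv₀ (f.continuous.continuousAt.comp (continuousAt_inv₀ hw)) ?_
    rw [← h0]
    exact f.injective.ne (inv_ne_zero hw)

/-- Conjugation by inversion of a plane homeomorphism fixing the origin. -/
noncomputable def Homeomorph.conjInv (f : ℂ ≃ₜ ℂ) (h0 : f 0 = 0) : ℂ ≃ₜ ℂ where
  toFun w := (f w⁻¹)⁻¹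
  invFun w := (f.symm w⁻¹)⁻¹
  left_inv w := by simp
  right_inv w := by simp
  continuous_toFun := f.continuous_inv_comp_inv h0
  continuous_invFun := f.symm.continuous_inv_comp_inv (by rw [f.symm_apply_eq, h0])

theorem Homeomorph.conjInv_apply (f : ℂ ≃ₜ ℂ) (h0 : f 0 = 0) (w : ℂ) :
    f.conjInv h0 w = (f w⁻¹)⁻¹ := rfl

theorem Homeomorph.differentiable_conjInv (f : ℂ ≃ₜ ℂ) (h0 : f 0 = 0)
    (hf : Differentiable ℂ f) : Differentiable ℂ (f.conjInv h0) := by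
  have hne : ∀ w : ℂ, w ≠ 0 → DifferentiableAt ℂ (f.conjInv h0) w := by
    intro w hw
    refine DifferentiableAt.inv ((hf _).comp w (differentiableAt_inv hw)) ?_
    exact fun hw' => inv_ne_zero hw (f.injective (hw'.trans h0.symm))
  intro w
  by_cases hw : w = 0
  · subst hw
    exact (analyticAt_of_differentiable_on_punctured_nhds_of_continuousAt
      (eventually_mem_nhdsWithin.mono hne)
      (f.conjInv h0).continuous.continuousAt).differentiableAt
  · exact hne w hw

/-- An entire homeomorphism of the plane fixing the origin is linear. -/
theorem Homeomorph.exists_eq_mul_of_differentiable (f : ℂ ≃ₜ ℂ) (hf : Differentiable ℂ f)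
    (h0 : f 0 = 0) : ∃ a : ℂ, a ≠ 0 ∧ ∀ z, f z = a * z := by
  let G := f.conjInv h0
  have hGd := f.differentiable_conjInv h0 hf
  have hG' := G.deriv_ne_zero_of_differentiable hGd 0
  have hk : Differentiable ℂ (dslope f 0) := by
    rw [← differentiableOn_univ] at hf ⊢
    exact (differentiableOn_dslope univ_mem).2 hf
  have ht : Tendsto (dslope f 0) (cocompact ℂ) (𝓝 (deriv G 0)⁻¹) := by
    have h1 := ((hasDerivAt_iff_tendsto_slope.1 (hGd 0).hasDerivAt).inv₀ hG').comp
      (tendsto_inv₀_cobounded' (α := ℂ))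
    rw [← Metric.cobounded_eq_cocompact]
    refine h1.congr' ?_
    filter_upwards [Bornology.eventually_ne_cobounded (0 : ℂ)] with z hz
    rw [dslope_of_ne _ hz]
    simp [slope_def_field, conjInv_apply, h0, div_eq_mul_inv, mul_comm]
  refine ⟨(deriv G 0)⁻¹, inv_ne_zero hG', fun z => ?_⟩
  have h2 := sub_smul_dslope f 0 z
  rw [hk.apply_eq_of_tendsto_cocompact z ht] at h2
  simpa [h0, mul_comm] using h2.symm

/-- An entire homeomorphism of the plane is affine. -/
theorem Homeomorph.exists_eq_mul_add_of_differentiable (f : ℂ ≃ₜ ℂ) (hf : Differentiable ℂ f) :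
    ∃ a b : ℂ, a ≠ 0 ∧ ∀ z, f z = a * z + b := by
  obtain ⟨a, ha, h⟩ := (f.trans (Homeomorph.subRight (f 0))).exists_eq_mul_of_differentiable
    (hf.sub_const (f 0)) (by simp)
  exact ⟨a, f 0, ha, fun z => sub_eq_iff_eq_add.1 (h z)⟩

theorem Complex.isOpenQuotientMap_sin : IsOpenQuotientMap sin := by
  refine ⟨sin_surjective, continuous_sin, ?_⟩
  have ha : AnalyticOnNhd ℂ sin Set.univ := fun z _ => differentiable_sin.analyticAt z
  refine ha.is_constant_or_isOpenMap.resolve_left ?_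
  rintro ⟨w, hw⟩
  obtain ⟨x, hx⟩ := sin_surjective (w + 1)
  simp [hw x] at hx

/-- A continuous function `F` for which `F ∘ sin` is entire is itself entire. -/
theorem differentiable_of_comp_sin {F G : ℂ → ℂ} (hF : Continuous F) (hG : Differentiable ℂ G)
    (h : ∀ z, F (sin z) = G z) : Differentiable ℂ F := by
  have hregular : ∀ w : ℂ, w ^ 2 ≠ 1 → DifferentiableAt ℂ F w := by
    intro w hw
    obtain ⟨x, rfl⟩ := sin_surjective w
    have hc : cos x ≠ 0 := fun hc => hw (by simpa [hc] using sin_sq_add_cos_sq x)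
    have hs := hasStrictDerivAt_sin x
    have he := (hs.to_localInverse hc).hasDerivAt.differentiableAt
    refine (DifferentiableAt.comp (sin x) (hG _) he).congr_of_eventuallyEq ?_
    filter_upwards [hs.eventually_right_inverse hc] with y hy
    rw [Function.comp_apply, ← h, hy]
  intro w
  have hne : ∀ᶠ y in 𝓝[≠] w, y ^ 2 ≠ 1 := by
    have hfin : ({1, -1} : Set ℂ).Finite := by simp
    filter_upwards [(hfin.subset Set.sdiff_subset).isClosed.isOpen_compl.mem_nhds
      (Set.notMem_sdiff_of_mem (Set.mem_singleton w)) |> mem_nhdsWithin_of_mem_nhds,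
      self_mem_nhdsWithin] with y hy hyw
    exact fun h1 => hy ⟨sq_eq_one_iff.1 h1, hyw⟩
  exact (analyticAt_of_differentiable_on_punctured_nhds_of_continuousAt
    (hne.mono hregular) hF.continuousAt).differentiableAt

/-- An entire function with the same fibres as `sin` and onto `ℂ` is an affine function of
`sin`. -/
theorem exists_eq_mul_sin_add {G : ℂ → ℂ} (hG : Differentiable ℂ G)
    (hsurj : Function.Surjective G) (hfib : ∀ z w, G z = G w ↔ sin z = sin w) :
    ∃ a d : ℂ, a ≠ 0 ∧ ∀ z, G z = a * sin z + d := by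
  obtain ⟨s, hs⟩ := sin_surjective.hasRightInverse
  have hF : ∀ z, G (s (sin z)) = G z := fun z => (hfib _ _).2 (hs _)
  have hFc : Continuous (G ∘ s) := by
    rw [Complex.isOpenQuotientMap_sin.isQuotientMap.continuous_iff]
    exact hG.continuous.congr fun z => (hF z).symm
  have hFd : Differentiable ℂ (G ∘ s) := differentiable_of_comp_sin hFc hG hF
  have hFi : Function.Injective (G ∘ s) := fun x y hxy => by
    simpa [hs x, hs y] using (hfib _ _).1 hxy
  have hFs : Function.Surjective (G ∘ s) := fun y =>
    let ⟨x, hx⟩ := hsurj y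
    ⟨sin x, (hF x).trans hx⟩
  have hFo : IsOpenMap (G ∘ s) := by
    have ha : AnalyticOnNhd ℂ (G ∘ s) Set.univ := fun z _ => hFd.analyticAt z
    refine ha.is_constant_or_isOpenMap.resolve_left ?_
    rintro ⟨w, hw⟩
    exact zero_ne_one (hFi ((hw 0).trans (hw 1).symm))
  obtain ⟨a, d, ha, h⟩ := ((Equiv.ofBijective _ ⟨hFi, hFs⟩).toHomeomorphOfContinuousOpen
    hFc hFo).exists_eq_mul_add_of_differentiable hFd
  exact ⟨a, d, ha, fun z => (hF z).symm.trans (h (sin z))⟩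

/-- If an entire function `g` is topologically equivalent to `sin` (i.e. there are plane
homeomorphisms `φ, ψ` with `φ (sin z) = g (ψ z)`), then `g z = a·sin(b·z + c) + d`
with `a·b ≠ 0`. -/
theorem sine_topological_rigidity (g : ℂ → ℂ) (hg : Differentiable ℂ g)
    (φ ψ : ℂ ≃ₜ ℂ) (h : ∀ z : ℂ, φ (Complex.sin z) = g (ψ z)) :
    ∃ a b c d : ℂ, a * b ≠ 0 ∧ ∀ z : ℂ, g z = a * Complex.sin (b * z + c) + d := by
  have hgs : Function.Surjective g := fun y => by
    obtain ⟨x, hx⟩ := sin_surjective (φ.symm y)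
    exact ⟨ψ x, by rw [← h, hx, φ.apply_symm_apply]⟩
  have hfib : ∀ x y, g (ψ x) = g (ψ y) ↔ sin x = sin y := fun x y => by
    rw [← h, ← h, φ.injective.eq_iff]
  have hg' : deriv g ≠ 0 := by
    obtain ⟨x, hx⟩ := hgs 0
    obtain ⟨y, hy⟩ := hgs 1
    exact deriv_ne_zero_of_apply_ne hg (x := x) (y := y) (by simp [hx, hy])
  have haffine : ∀ σ : ℂ ≃ₜ ℂ, (∀ z, sin (σ z) = sin z) →
      ∃ α β : ℂ, ∀ x, ψ (σ x) = α * ψ x + β := by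
    intro σ hσ
    let γ : ℂ ≃ₜ ℂ := (ψ.symm.trans σ).trans ψ
    have hγ : Differentiable ℂ γ := by
      refine differentiable_of_comp_eq hg hg' hg γ.continuous γ.injective fun z => ?_
      have := (hfib (σ (ψ.symm z)) (ψ.symm z)).2 (hσ _)
      rwa [ψ.apply_symm_apply] at this
    obtain ⟨α, β, -, hγ'⟩ := γ.exists_eq_mul_add_of_differentiable hγ
    exact ⟨α, β, fun x => by simpa [γ] using hγ' (ψ x)⟩
  have hπ : (2 * Real.pi : ℂ) ≠ 0 := by simp [Real.pi_ne_zero]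
  obtain ⟨τ, hτ, hT⟩ : ∃ τ : ℂ, τ ≠ 0 ∧ ∀ x, ψ (x + 2 * Real.pi) = ψ x + τ := by
    obtain ⟨α, τ, hT⟩ := haffine (Homeomorph.addRight (2 * Real.pi)) sin_add_two_pi
    simp only [Homeomorph.coe_addRight] at hT
    have hfix : ∀ x, ψ (x + 2 * Real.pi) ≠ ψ x := fun x hx => by
      simpa [Real.pi_ne_zero] using ψ.injective hx
    have hα : α = 1 := by
      by_contra hα
      have hα' : 1 - α ≠ 0 := sub_ne_zero.2 (Ne.symm hα)
      apply hfix (ψ.symm (τ / (1 - α)))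
      rw [hT, ψ.apply_symm_apply]
      field_simp
      ring
    subst hα
    refine ⟨τ, ?_, fun x => by rw [hT, one_mul]⟩
    rintro rfl
    exact hfix 0 (by rw [hT]; ring)
  obtain ⟨β, hR⟩ : ∃ β : ℂ, ∀ x, ψ (Real.pi - x) = β - ψ x := by
    obtain ⟨α, β, hR⟩ := haffine (Homeomorph.subLeft (Real.pi : ℂ)) sin_pi_sub
    simp only [Homeomorph.coe_subLeft] at hR
    have hinv : ∀ x, ψ x = α * (α * ψ x + β) + β := fun x => by
      rw [← hR, ← hR, sub_sub_cancel]
    have h0 := hinv (ψ.symm 0)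
    have h1 := hinv (ψ.symm 1)
    rw [ψ.apply_symm_apply] at h0 h1
    have hsq : α ^ 2 = 1 := by linear_combination h0 - h1
    rcases sq_eq_one_iff.1 hsq with rfl | rfl
    · have hβ : β = 0 := by linear_combination -h0 / 2
      have hfix := hR 0
      rw [hβ, one_mul, add_zero] at hfix
      simpa [Real.pi_ne_zero] using ψ.injective hfix
    · exact ⟨β, fun x => by rw [hR]; ring⟩
  have hTk : ∀ (k : ℤ) (x : ℂ), ψ (x + k * (2 * Real.pi)) = ψ x + k * τ := by
    intro k x
    induction k with
    | zero => simp
    | succ n ih =>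
      have hstep := hT (x + (n : ℤ) * (2 * Real.pi))
      rw [ih, add_assoc, ← add_one_mul, add_assoc, ← add_one_mul] at hstep
      exact_mod_cast hstep
    | pred n ih =>
      have hstep := hT (x + (-n - 1 : ℤ) * (2 * Real.pi))
      rw [add_assoc, ← add_one_mul] at hstep
      push_cast at ih hstep ⊢
      rw [sub_add_cancel, ih] at hstep
      linear_combination -hstep
  set m : ℂ := τ / (2 * Real.pi) with hm
  set e : ℂ := (β - τ / 2) / 2 with he
  have hm0 : m ≠ 0 := div_ne_zero hτ hπ
  have hmπ : m * Real.pi = τ / 2 := by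
    rw [hm]
    field_simp
  obtain ⟨a, d, ha, hG⟩ := exists_eq_mul_sin_add (G := fun z => g (m * z + e))
    (by fun_prop)
    (fun y => by
      obtain ⟨x, hx⟩ := hgs y
      exact ⟨(x - e) / m, by simpa [mul_div_cancel₀ _ hm0] using hx⟩)
    (fun z w => by
      have hzw := hfib (ψ.symm (m * z + e)) (ψ.symm (m * w + e))
      simp only [ψ.apply_symm_apply] at hzw
      rw [hzw, sin_eq_sin_iff, sin_eq_sin_iff]
      refine exists_congr fun k => or_congr ?_ ?_
      · rw [ψ.symm_apply_eq, add_comm (2 * k * Real.pi : ℂ), mul_comm (2 : ℂ), mul_assoc, hTk,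
          ψ.apply_symm_apply, ← mul_right_inj' (a := m) (b := w) hm0]
        constructor <;> intro hk
        · linear_combination hk - 2 * k * hmπ
        · linear_combination hk + 2 * k * hmπ
      · have hsplit : ((2 * k + 1) * Real.pi - ψ.symm (m * z + e) : ℂ) =
            (Real.pi - ψ.symm (m * z + e)) + k * (2 * Real.pi) := by ring
        rw [ψ.symm_apply_eq, hsplit, hTk, hR, ψ.apply_symm_apply,
          ← mul_right_inj' (a := m) (b := w) hm0]
        constructor <;> intro hk
        · linear_combination hk - (2 * k + 1) * hmπ - 2 * he
        · linear_combination hk + (2 * k + 1) * hmπ + 2 * he)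
  refine ⟨a, m⁻¹, -(m⁻¹ * e), d, mul_ne_zero ha (inv_ne_zero hm0), fun z => ?_⟩
  rw [← mul_neg, ← mul_add, ← hG]
  congr 1
  field_simp
  ring
end

section
/- Let λ ∈ ℂ with λ ≠ 0 and g(w) = λ·sin w. Let S ⊂ ℂ be a finite set and let q̃ : ℂ → ℂ be holomorphic on ℂ \ S and integrable on ℂ with respect to Lebesgue measure. Assume that for Lebesgue-almost every z ∈ ℂ the family (q̃(w)/(g'(w))²) indexed by w ∈ g⁻¹(z) is absolutely summable, and let q(z) = ∑_{w ∈ g⁻¹(z)} q̃(w)/(g'(w))² be the push-forward of q̃ through g. Then ∫_ℂ |q(z)| dz ≤ ∫_ℂ |q̃(w)| dw. -/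
open MeasureTheory Complex

/-- The real Jacobian of multiplication by the complex number `c` is `‖c‖ ^ 2`. -/
theorem Complex.det_restrictScalars_toSpanSingleton (c : ℂ) :
    ((ContinuousLinearMap.toSpanSingleton ℂ c).restrictScalars ℝ).det = ‖c‖ ^ 2 := by
  have h : LinearMap.det (ContinuousLinearMap.toSpanSingleton ℂ c : ℂ →ₗ[ℂ] ℂ) = c := by
    rw [← LinearMap.det_toMatrix (Module.Basis.singleton Unit ℂ)]
    simp [LinearMap.toMatrix_apply]
  have h2 := LinearMap.det_restrictScalars (R := ℝ)
    (f := (ContinuousLinearMap.toSpanSingleton ℂ c : ℂ →ₗ[ℂ] ℂ))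
  rw [h, Algebra.norm_complex_apply, Complex.normSq_eq_norm_sq] at h2
  exact h2

section Fiber

variable {g g' : ℂ → ℂ} {B : Set ℂ} {h : ℂ → ENNReal}

theorem tsum_fiber_inter_eq_of_mem (hinj : Set.InjOn g B) {x : ℂ} (hx : x ∈ B) :
    ∑' w : (g ⁻¹' {g x} ∩ B : Set ℂ), h w = h x := by
  have : (g ⁻¹' {g x} ∩ B : Set ℂ) = {x} := by
    ext y
    simp only [Set.mem_inter_iff, Set.mem_preimage, Set.mem_singleton_iff]
    exact ⟨fun hy => hinj hy.2 hx hy.1, by rintro rfl; exact ⟨rfl, hx⟩⟩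
  rw [this, tsum_singleton x h]

theorem tsum_fiber_inter_eq_zero {z : ℂ} (hz : z ∉ g '' B) :
    ∑' w : (g ⁻¹' {z} ∩ B : Set ℂ), h w = 0 := by
  have : (g ⁻¹' {z} ∩ B : Set ℂ) = ∅ := by
    ext y
    simp only [Set.mem_inter_iff, Set.mem_preimage, Set.mem_singleton_iff,
      Set.mem_empty_iff_false, iff_false]
    exact fun hy => hz ⟨y, hy.2, hy.1⟩
  rw [this, tsum_empty]

theorem measurable_tsum_fiber_inter (hB : MeasurableSet B) (hg : ContinuousOn g B)
    (hinj : Set.InjOn g B) (hh : Measurable h) :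
    Measurable fun z => ∑' w : (g ⁻¹' {z} ∩ B : Set ℂ), h w := by
  have he : MeasurableEmbedding (fun x : B => g x) := hg.measurableEmbedding hB hinj
  convert he.measurable_extend (hh.comp measurable_subtype_coe)
    (measurable_const (a := (0 : ENNReal))) using 1
  ext z
  by_cases hz : z ∈ g '' B
  · obtain ⟨x, hx, rfl⟩ := hz
    rw [tsum_fiber_inter_eq_of_mem hinj hx]
    exact (he.injective.extend_apply (h ∘ Subtype.val) (fun _ => 0) ⟨x, hx⟩).symm
  · rw [tsum_fiber_inter_eq_zero hz, Function.extend_apply']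
    rintro ⟨a, ha⟩
    exact hz ⟨a, a.2, ha⟩

/-- Change of variables for an injective holomorphic function, in terms of sums over fibers. -/
theorem lintegral_tsum_fiber_inter_of_injOn (hB : MeasurableSet B)
    (hg : ∀ x ∈ B, HasDerivAt g (g' x) x) (hinj : Set.InjOn g B) :
    ∫⁻ z, ∑' w : (g ⁻¹' {z} ∩ B : Set ℂ), h w =
      ∫⁻ w in B, ENNReal.ofReal (‖g' w‖ ^ 2) * h w := by
  have hcont : ContinuousOn g B := fun x hx => (hg x hx).continuousAt.continuousWithinAt
  have him : MeasurableSet (g '' B) := hB.image_of_continuousOn_injOn hcont hinj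
  have key := lintegral_image_eq_lintegral_abs_det_fderiv_mul volume hB
    (f' := fun x => (ContinuousLinearMap.toSpanSingleton ℂ (g' x)).restrictScalars ℝ)
    (fun x hx => ((hg x hx).hasFDerivAt.restrictScalars ℝ).hasFDerivWithinAt) hinj
    (fun z => ∑' w : (g ⁻¹' {z} ∩ B : Set ℂ), h w)
  rw [setLIntegral_eq_of_support_subset] at key
  · rw [key]
    refine setLIntegral_congr_fun hB fun x hx => ?_
    simp only [Complex.det_restrictScalars_toSpanSingleton, abs_of_nonneg (sq_nonneg ‖g' x‖)]
    rw [tsum_fiber_inter_eq_of_mem hinj hx]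
  · intro z hz
    by_contra hz'
    exact hz (tsum_fiber_inter_eq_zero hz')

/-- Change of variables for a locally injective holomorphic function, with multiplicity. -/
theorem lintegral_tsum_fiber_inter (hB : MeasurableSet B)
    (hg : ∀ x ∈ B, HasStrictDerivAt g (g' x) x) (hg' : ∀ x ∈ B, g' x ≠ 0) (hh : Measurable h) :
    ∫⁻ z, ∑' w : (g ⁻¹' {z} ∩ B : Set ℂ), h w =
      ∫⁻ w in B, ENNReal.ofReal (‖g' w‖ ^ 2) * h w := by
  have hloc : ∀ x : ℂ, ∃ U : Set ℂ, IsOpen U ∧ Set.InjOn g U ∧ (x ∈ B → x ∈ U) := by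
    intro x
    by_cases hx : x ∈ B
    · have hf := (hg x hx).hasStrictFDerivAt_equiv (hg' x hx)
      refine ⟨(hf.toOpenPartialHomeomorph g).source, (hf.toOpenPartialHomeomorph g).open_source,
        ?_, fun _ => hf.mem_toOpenPartialHomeomorph_source⟩
      simpa using (hf.toOpenPartialHomeomorph g).injOn
    · exact ⟨∅, isOpen_empty, Set.injOn_empty _, fun h => absurd h hx⟩
  choose U hUo hUi hUm using hloc
  obtain ⟨t, -, htc, hcov⟩ := TopologicalSpace.countable_cover_nhdsWithin (f := U) (s := B)
    fun x hx => mem_nhdsWithin_of_mem_nhds ((hUo x).mem_nhds (hUm x hx))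
  rcases B.eq_empty_or_nonempty with rfl | ⟨b, hb⟩
  · simp
  have htne : t.Nonempty := by
    obtain ⟨x, hx, -⟩ := Set.mem_iUnion₂.1 (hcov hb)
    exact ⟨x, hx⟩
  obtain ⟨p, rfl⟩ := htc.exists_eq_range htne
  set D : ℕ → Set ℂ := fun n => disjointed (fun n => U (p n)) n ∩ B with hD
  have hDm : ∀ n, MeasurableSet (D n) := fun n =>
    (MeasurableSet.disjointed (fun i => (hUo (p i)).measurableSet) n).inter hB
  have hDd : Pairwise (Function.onFun Disjoint D) := fun i j hij =>
    (disjoint_disjointed (fun n => U (p n)) hij).mono Set.inter_subset_left Set.inter_subset_left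
  have hDB : ⋃ n, D n = B := by
    rw [hD, ← Set.iUnion_inter, iUnion_disjointed]
    exact Set.inter_eq_right.2 (by simpa using hcov)
  have hDi : ∀ n, Set.InjOn g (D n) := fun n =>
    (hUi (p n)).mono (Set.inter_subset_left.trans (disjointed_le (fun n => U (p n)) n))
  have hDs : ∀ n, D n ⊆ B := fun n => Set.inter_subset_right
  have hsplit : ∀ z, ∑' w : (g ⁻¹' {z} ∩ B : Set ℂ), h w =
      ∑' n, ∑' w : (g ⁻¹' {z} ∩ D n : Set ℂ), h w := by
    intro z
    rw [← ENNReal.tsum_biUnion (f := h) (t := fun n => g ⁻¹' {z} ∩ D n)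
      fun i _ j _ hij => (hDd hij).mono Set.inter_subset_right Set.inter_subset_right,
      ← Set.inter_iUnion, hDB]
  simp_rw [hsplit]
  rw [lintegral_tsum fun n => (measurable_tsum_fiber_inter (hDm n)
    (fun x hx => (hg x (hDs n hx)).hasDerivAt.continuousAt.continuousWithinAt)
    (hDi n) hh).aemeasurable]
  conv_rhs => rw [← hDB, lintegral_iUnion hDm hDd]
  exact tsum_congr fun n => lintegral_tsum_fiber_inter_of_injOn (hDm n)
    (fun x hx => (hg x (hDs n hx)).hasDerivAt) (hDi n)

end Fiber

theorem Complex.countable_cos_eq_zero : {w : ℂ | Complex.cos w = 0}.Countable := by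
  refine (Set.countable_range fun k : ℤ => (2 * (k : ℂ) + 1) * Real.pi / 2).mono fun w hw => ?_
  obtain ⟨k, hk⟩ := Complex.cos_eq_zero_iff.1 hw
  exact ⟨k, hk.symm⟩

/-- The push-forward of an integrable quadratic differential `q̃` through `g(w) = λ·sin w`
does not increase the `L¹`-norm. -/
theorem pushforward_norm_le (lam : ℂ) (hlam : lam ≠ 0)
    (g : ℂ → ℂ) (hg : ∀ w : ℂ, g w = lam * Complex.sin w)
    (S : Set ℂ) (hS : S.Finite)
    (qt : ℂ → ℂ) (hqt : ∀ w : ℂ, w ∉ S → DifferentiableAt ℂ qt w)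
    (hint : Integrable qt)
    (hsum : ∀ᵐ z : ℂ, Summable fun w : (g ⁻¹' {z}) =>
      ‖qt ↑w / (lam * Complex.cos ↑w) ^ 2‖)
    (q : ℂ → ℂ)
    (hq : ∀ z : ℂ, q z = ∑' w : (g ⁻¹' {z}), qt ↑w / (lam * Complex.cos ↑w) ^ 2) :
    ∫⁻ z : ℂ, (‖q z‖₊ : ENNReal) ≤ ∫⁻ w : ℂ, (‖qt w‖₊ : ENNReal) := by
  set C : Set ℂ := S ∪ {w : ℂ | Complex.cos w = 0}
  have hCc : C.Countable := hS.countable.union Complex.countable_cos_eq_zero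
  have hqm : Measurable qt := by
    have hcont : ContinuousOn qt Sᶜ := fun x hx => (hqt x hx).continuousAt.continuousWithinAt
    exact measurable_of_measurable_on_compl_finite S hS hcont.domRestrict.measurable
  set h : ℂ → ENNReal := fun w => ‖qt w / (lam * Complex.cos w) ^ 2‖ₑ with hh
  have hhm : Measurable h := by
    have : Measurable Complex.cos := Complex.continuous_cos.measurable
    fun_prop
  have hder : ∀ x, HasStrictDerivAt g (lam * Complex.cos x) x := by
    intro x
    rw [funext hg]
    exact (Complex.hasStrictDerivAt_sin x).const_mul lam
  have hnull : ∀ᵐ z : ℂ, z ∉ g '' C :=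
    measure_eq_zero_iff_ae_notMem.1 ((hCc.image g).measure_zero volume)
  calc ∫⁻ z : ℂ, (‖q z‖₊ : ENNReal)
      ≤ ∫⁻ z, ∑' w : (g ⁻¹' {z} ∩ Cᶜ : Set ℂ), h w := by
        refine lintegral_mono_ae ?_
        filter_upwards [hnull] with z hz
        have hfib : (g ⁻¹' {z} ∩ Cᶜ : Set ℂ) = g ⁻¹' {z} :=
          Set.inter_eq_left.2 fun w hw hwC => hz ⟨w, hwC, hw⟩
        rw [hfib, hq z]
        exact enorm_tsum_le_tsum_enorm
    _ = ∫⁻ w in Cᶜ, ENNReal.ofReal (‖lam * Complex.cos w‖ ^ 2) * h w :=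
        lintegral_tsum_fiber_inter hCc.measurableSet.compl (fun x _ => hder x)
          (fun x hx => mul_ne_zero hlam fun h0 => hx (Or.inr h0)) hhm
    _ = ∫⁻ w in Cᶜ, (‖qt w‖₊ : ENNReal) := by
        refine setLIntegral_congr_fun hCc.measurableSet.compl fun w hw => ?_
        have hne : lam * Complex.cos w ≠ 0 := mul_ne_zero hlam fun h0 => hw (Or.inr h0)
        change _ = ‖qt w‖ₑ
        rw [← norm_pow, ofReal_norm, hh, ← enorm_mul, mul_div_cancel₀ _ (pow_ne_zero 2 hne)]
    _ ≤ ∫⁻ w : ℂ, (‖qt w‖₊ : ENNReal) := setLIntegral_le_lintegral _ _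
end

section
/- Let a, b, c, d ∈ ℂ with a·b ≠ 0 and g(w) = a·sin(b·w + c) + d. Let S ⊂ ℂ be a finite set, let q̃ : ℂ → ℂ be holomorphic on ℂ \ S, integrable on ℂ, with ∫_ℂ |q̃(w)| dw = 1. Assume that for Lebesgue-almost every z the family (q̃(w)/(g'(w))²) over w ∈ g⁻¹(z) is absolutely summable, and let q(z) = ∑_{w ∈ g⁻¹(z)} q̃(w)/(g'(w))². Then ∫_ℂ |q(z)| dz < 1, i.e., the push-forward through g strictly decreases the L¹-norm. -/
open MeasureTheory Complex

open Set in
/-- Area formula for an entire function that is injective on each piece of a countable measurable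
partition of `ℂ`. -/
theorem lintegral_tsum_fiber {ι : Type*} [Countable ι] [MeasurableSpace ι]
    [MeasurableSingletonClass ι] {g g' : ℂ → ℂ} (hg : ∀ w, HasDerivAt g (g' w) w)
    {κ : ℂ → ι} (hκ : Measurable κ) (hinj : ∀ i, InjOn g (κ ⁻¹' {i}))
    {f : ℂ → ENNReal} (hf : Measurable f) :
    Measurable (fun z => ∑' w : g ⁻¹' {z}, f w) ∧
      ∫⁻ z, ∑' w : g ⁻¹' {z}, f w = ∫⁻ w, ENNReal.ofReal (‖g' w‖ ^ 2) * f w := by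
  have hA : ∀ i, MeasurableSet (κ ⁻¹' {i}) := fun i => hκ (measurableSet_singleton i)
  have hcont : Continuous g := continuous_iff_continuousAt.2 fun w => (hg w).continuousAt
  let h : ι → ℂ → ENNReal := fun i =>
    Function.extend ((κ ⁻¹' {i}).domRestrict g) (fun w => f w) 0
  have hext : ∀ i, ∀ w ∈ κ ⁻¹' {i}, h i (g w) = f w := fun i w hw =>
    (injOn_iff_injective.1 (hinj i)).extend_apply (fun w : κ ⁻¹' {i} => f w) 0 ⟨w, hw⟩
  have hzero : ∀ i, ∀ z ∉ g '' (κ ⁻¹' {i}), h i z = 0 := by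
    intro i z hz
    refine Function.extend_apply' _ _ _ ?_
    rintro ⟨w, rfl⟩
    exact hz ⟨w, w.2, rfl⟩
  have hmeas : ∀ i, Measurable (h i) := fun i =>
    (hcont.continuousOn.measurableEmbedding (hA i) (hinj i)).measurable_extend
      (hf.comp measurable_subtype_coe) measurable_const
  have hsum : ∀ z, ∑' w : g ⁻¹' {z}, f w = ∑' i, h i z := by
    intro z
    have h1 : ∀ w : g ⁻¹' {z}, f w = ∑' i, (κ ⁻¹' {i}).indicator f w := by
      intro w
      rw [tsum_eq_single (κ w)]
      · simp
      · intro i hi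
        exact indicator_of_notMem (fun h => hi h.symm) _
    simp_rw [h1]
    rw [ENNReal.tsum_comm]
    refine tsum_congr fun i => ?_
    by_cases hz : z ∈ g '' (κ ⁻¹' {i})
    · obtain ⟨x, hx, rfl⟩ := hz
      rw [hext i x hx, tsum_eq_single (⟨x, rfl⟩ : g ⁻¹' {g x})]
      · exact indicator_of_mem hx _
      · rintro ⟨w, hw⟩ hne
        refine indicator_of_notMem (fun hwi => hne ?_) _
        exact Subtype.ext (hinj i hwi hx hw)
    · rw [hzero i z hz, ENNReal.tsum_eq_zero]
      rintro ⟨w, hw⟩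
      exact indicator_of_notMem (fun hwi => hz ⟨w, hwi, hw⟩) _
  refine ⟨by simp_rw [hsum]; exact Measurable.tsum hmeas, ?_⟩
  simp_rw [hsum]
  rw [lintegral_tsum fun i => (hmeas i).aemeasurable]
  have hdet : ∀ w, |((fderiv ℂ g w).restrictScalars ℝ).det| = ‖g' w‖ ^ 2 := by
    intro w
    have : ((fderiv ℂ g w).restrictScalars ℝ).det = Complex.normSq (g' w) := by
      rw [ContinuousLinearMap.det, ContinuousLinearMap.coe_restrictScalars,
        LinearMap.det_restrictScalars, Algebra.norm_complex_apply, (hg w).hasFDerivAt.fderiv]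
      simp
    rw [this, abs_of_nonneg (Complex.normSq_nonneg _), Complex.normSq_eq_norm_sq]
  have hi : ∀ i, ∫⁻ z, h i z = ∫⁻ w in κ ⁻¹' {i}, ENNReal.ofReal (‖g' w‖ ^ 2) * f w := by
    intro i
    have himg : MeasurableSet (g '' (κ ⁻¹' {i})) :=
      (hA i).image_of_continuousOn_injOn hcont.continuousOn (hinj i)
    rw [← setLIntegral_eq_of_support_subset (s := g '' (κ ⁻¹' {i})),
      lintegral_image_eq_lintegral_abs_det_fderiv_mul volume (hA i)
        (fun w _ => ((hg w).differentiableAt.hasFDerivAt.restrictScalars ℝ).hasFDerivWithinAt)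
        (hinj i)]
    · refine setLIntegral_congr_fun (hA i) fun w hw => ?_
      simp only [hdet, hext i w hw]
    · intro z hz
      by_contra hn
      exact hz (hzero i z hn)
  simp_rw [hi]
  rw [← lintegral_iUnion hA, ← preimage_iUnion, iUnion_of_singleton, preimage_univ,
    Measure.restrict_univ]
  intro i j hij
  exact Disjoint.preimage _ (by simpa using hij)

theorem norm_add_eq_of_norm_tsum_eq {ι E : Type*} [NormedAddCommGroup E] [CompleteSpace E]
    {f : ι → E} (hf : Summable fun i => ‖f i‖) (h : ‖∑' i, f i‖ = ∑' i, ‖f i‖) {i j : ι}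
    (hij : i ≠ j) : ‖f i + f j‖ = ‖f i‖ + ‖f j‖ := by
  classical
  refine le_antisymm (norm_add_le _ _) ?_
  have h1 := hf.of_norm.sum_add_tsum_compl (s := {i, j})
  have h2 := hf.sum_add_tsum_compl (s := {i, j})
  rw [Finset.sum_pair hij] at h1 h2
  have h3 := norm_add_le (f i + f j) (∑' x : ↑((({i, j} : Finset ι) : Set ι)ᶜ), f x)
  have h4 : ‖∑' x : ↑((({i, j} : Finset ι) : Set ι)ᶜ), f x‖ ≤ _ :=
    norm_tsum_le_tsum_norm (hf.subtype _)
  rw [h1] at h3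
  linarith

/-- Holomorphic functions with pointwise the same argument on a connected open set are
proportional. -/
theorem exists_eq_const_mul_of_sameRay {U : Set ℂ} (hU : IsOpen U) (hUc : IsPreconnected U)
    {p r : ℂ → ℂ} (hp : DifferentiableOn ℂ p U) (hr : DifferentiableOn ℂ r U)
    (h : ∀ w ∈ U, SameRay ℝ (p w) (r w)) {w₀ : ℂ} (hw₀ : w₀ ∈ U) (hp₀ : p w₀ ≠ 0) :
    ∃ l : ℂ, ∀ w ∈ U, r w = l * p w := by
  have hpa := hp.analyticOnNhd hU
  have hra := hr.analyticOnNhd hU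
  have hq : AnalyticAt ℂ (fun w => r w / p w) w₀ := (hra w₀ hw₀).div (hpa w₀ hw₀) hp₀
  have him : ∀ᶠ w in nhds w₀, p w ≠ 0 ∧ (r w / p w).im = 0 := by
    filter_upwards [(hpa w₀ hw₀).continuousAt.eventually_ne hp₀, hU.mem_nhds hw₀] with w hw hwU
    refine ⟨hw, ?_⟩
    obtain ⟨t, -, ht⟩ := (h w hwU).exists_nonneg_left hw
    rw [← ht, Complex.real_smul, mul_div_cancel_right₀ _ hw, Complex.ofReal_im]
  have hconst : ∀ᶠ w in nhds w₀, r w / p w = r w₀ / p w₀ := by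
    refine hq.eventually_constant_or_nhds_le_map_nhds.resolve_right fun hle => ?_
    have hmem : {z : ℂ | z.im = 0} ∈ nhds (r w₀ / p w₀) := hle (him.mono fun w hw => hw.2)
    have hint : interior {z : ℂ | z.im = 0} = ∅ := by
      exact (Complex.interior_preimage_im {0}).trans (by simp)
    have := mem_interior_iff_mem_nhds.2 hmem
    simp [hint] at this
  refine ⟨r w₀ / p w₀, AnalyticOnNhd.eqOn_of_preconnected_of_eventuallyEq hra
    (analyticOnNhd_const.mul hpa) hUc hw₀ ?_⟩
  filter_upwards [him, hconst] with w hw hc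
  rw [← hc, div_mul_cancel₀ _ hw.1]

open Set in
theorem lintegral_eq_zero_or_top_of_periodic {f : ℂ → ENNReal} {T : ℂ} (hT : T ≠ 0)
    (hf : ∀ᵐ w, f (w + T) = f w) : ∫⁻ w, f w = 0 ∨ ∫⁻ w, f w = ⊤ := by
  let κ : ℂ → ℤ := fun w => ⌊(w / T).re⌋
  have hκ : Measurable κ :=
    Int.measurable_floor.comp (Complex.measurable_re.comp (measurable_id.div_const T))
  have hA : ∀ n, MeasurableSet (κ ⁻¹' {n}) := fun n => hκ (measurableSet_singleton n)
  have hstep : ∀ n, ∫⁻ w in κ ⁻¹' {n + 1}, f w = ∫⁻ w in κ ⁻¹' {n}, f w := by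
    intro n
    rw [← (measurePreserving_add_right volume T).setLIntegral_comp_preimage_emb
      (measurableEmbedding_addRight T)]
    have : (fun w => w + T) ⁻¹' (κ ⁻¹' {n + 1}) = κ ⁻¹' {n} := by
      ext w
      simp [κ, add_div, div_self hT]
    rw [this]
    exact lintegral_congr_ae (ae_restrict_of_ae hf)
  have hall : ∀ n, ∫⁻ w in κ ⁻¹' {n}, f w = ∫⁻ w in κ ⁻¹' {0}, f w := by
    intro n
    induction n using Int.induction_on with
    | zero => rfl
    | succ n ih => rw [hstep, ih]
    | pred n ih => rw [← ih, ← hstep, sub_add_cancel]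
  have htot : ∫⁻ w, f w = ∑' _ : ℤ, ∫⁻ w in κ ⁻¹' {0}, f w := by
    rw [← tsum_congr hall, ← lintegral_iUnion hA, ← preimage_iUnion, iUnion_of_singleton,
      preimage_univ, Measure.restrict_univ]
    intro i j hij
    exact Disjoint.preimage _ (by simpa using hij)
  rw [htot]
  by_cases h0 : ∫⁻ w in κ ⁻¹' {0}, f w = 0
  · left; simp [h0]
  · right; exact ENNReal.tsum_const_eq_top_of_ne_zero h0

/-- The half strip of `ℂ`, of width `π` in the real direction, that contains a point; `sin` is
injective on each of them. -/
noncomputable def sinPiece (u : ℂ) : ℤ × Bool := (⌊u.re / Real.pi + 1 / 2⌋, decide (0 ≤ u.im))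

theorem measurable_sinPiece : Measurable sinPiece := by
  refine Measurable.prodMk (Int.measurable_floor.comp (by fun_prop)) ?_
  exact measurable_to_bool (by
    have : (fun u : ℂ => decide (0 ≤ u.im)) ⁻¹' {true} = {u : ℂ | 0 ≤ u.im} := by ext; simp
    rw [this]
    exact measurableSet_le measurable_const Complex.measurable_im)

theorem eq_of_sin_eq_of_sinPiece_eq {u v : ℂ} (hs : Complex.sin u = Complex.sin v)
    (hp : sinPiece u = sinPiece v) : u = v := by
  have hπ := Real.pi_pos
  have hfl : ⌊u.re / Real.pi + 1 / 2⌋ = ⌊v.re / Real.pi + 1 / 2⌋ := congrArg Prod.fst hp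
  have him : 0 ≤ u.im ↔ 0 ≤ v.im := by simpa [sinPiece] using congrArg Prod.snd hp
  obtain ⟨k, hk | hk⟩ := Complex.sin_eq_sin_iff.1 hs
  · have hre : v.re / Real.pi = 2 * k + u.re / Real.pi := by
      rw [hk]; simp; field_simp
    have : v.re / Real.pi + 1 / 2 = u.re / Real.pi + 1 / 2 + ((2 * k : ℤ) : ℝ) := by
      rw [hre]; push_cast; ring
    rw [this, Int.floor_add_intCast] at hfl
    have hk0 : k = 0 := by omega
    rw [hk, hk0]; simp
  · have hre : v.re / Real.pi = 2 * k + 1 - u.re / Real.pi := by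
      rw [hk]; simp; field_simp
    have hvim : v.im = -u.im := by rw [hk]; simp
    have hu0 : u.im = 0 := by
      rcases lt_trichotomy u.im 0 with h | h | h
      · exact absurd (him.2 (by linarith)) (by linarith)
      · exact h
      · exact absurd (him.1 h.le) (by linarith)
    set n := ⌊u.re / Real.pi + 1 / 2⌋
    have h1 : (n : ℝ) ≤ u.re / Real.pi + 1 / 2 := Int.floor_le _
    have h2 : u.re / Real.pi + 1 / 2 < n + 1 := Int.lt_floor_add_one _
    have h3 : (n : ℝ) ≤ v.re / Real.pi + 1 / 2 := hfl ▸ Int.floor_le _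
    have h4 : v.re / Real.pi + 1 / 2 < n + 1 := hfl ▸ Int.lt_floor_add_one _
    have h5 : 2 * n ≤ 2 * k + 2 := by exact_mod_cast (by linarith : (2 * n : ℝ) ≤ 2 * k + 2)
    have h6 : 2 * k + 2 < 2 * n + 2 := by
      exact_mod_cast (by linarith : (2 * k + 2 : ℝ) < 2 * n + 2)
    have h7 : (n : ℝ) = k + 1 := by exact_mod_cast (by omega : n = k + 1)
    refine Complex.ext ?_ (by rw [hvim, hu0, neg_zero])
    exact (div_left_inj' hπ.ne').1 (by linarith)

/-- The push-forward through `g(w) = a·sin(b·w + c) + d` (with `a·b ≠ 0`) strictly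
decreases the `L¹`-norm of a nonzero integrable quadratic differential. -/
theorem pushforward_strict_contraction (a b c d : ℂ) (hab : a * b ≠ 0)
    (g : ℂ → ℂ) (hg : ∀ w : ℂ, g w = a * Complex.sin (b * w + c) + d)
    (S : Set ℂ) (hS : S.Finite)
    (qt : ℂ → ℂ) (hqt : ∀ w : ℂ, w ∉ S → DifferentiableAt ℂ qt w)
    (hint : Integrable qt)
    (hnorm : ∫ w : ℂ, ‖qt w‖ = 1)
    (hsum : ∀ᵐ z : ℂ, Summable fun w : (g ⁻¹' {z}) =>
      ‖qt ↑w / (a * b * Complex.cos (b * ↑w + c)) ^ 2‖)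
    (q : ℂ → ℂ)
    (hq : ∀ z : ℂ, q z =
      ∑' w : (g ⁻¹' {z}), qt ↑w / (a * b * Complex.cos (b * ↑w + c)) ^ 2) :
    ∫⁻ z : ℂ, (‖q z‖₊ : ENNReal) < 1 := by
  have ha : a ≠ 0 := left_ne_zero_of_mul hab
  have hb : b ≠ 0 := right_ne_zero_of_mul hab
  set g' : ℂ → ℂ := fun w => a * b * Complex.cos (b * w + c) with hg'
  set F : ℂ → ℂ := fun w => qt w / g' w ^ 2 with hF
  have hderiv : ∀ w, HasDerivAt g (g' w) w := by
    intro w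
    have h1 : HasDerivAt (fun w : ℂ => b * w + c) b w := by
      simpa using ((hasDerivAt_id w).const_mul b).add_const c
    have h2 := ((h1.csin).const_mul a).add_const d
    rw [funext hg]
    exact h2.congr_deriv (by rw [hg']; ring)
  have hinj : ∀ i, Set.InjOn g ((fun w => sinPiece (b * w + c)) ⁻¹' {i}) := by
    intro i w hw v hv hwv
    simp only [hg, add_left_inj, mul_right_inj' ha] at hwv
    have := eq_of_sin_eq_of_sinPiece_eq hwv (Eq.trans hw (Eq.symm hv))
    simpa [hb] using this
  have hκ : Measurable fun w : ℂ => sinPiece (b * w + c) :=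
    measurable_sinPiece.comp (by fun_prop)
  have hqm : Measurable qt := by
    refine measurable_of_measurable_on_compl_finite S hS ?_
    exact (ContinuousOn.domRestrict fun w hw =>
      (hqt w hw).continuousAt.continuousWithinAt).measurable
  have hg'm : Measurable g' := by fun_prop
  have hFm : Measurable F := hqm.div (hg'm.pow_const 2)
  obtain ⟨hφm, hφ⟩ := lintegral_tsum_fiber hderiv hκ hinj hFm.enorm
  have hqt1 : ∫⁻ w, ‖qt w‖ₑ = 1 := by
    rw [← ofReal_integral_norm_eq_lintegral_enorm hint, hnorm, ENNReal.ofReal_one]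
  have hφ1 : ∫⁻ z, ∑' w : g ⁻¹' {z}, ‖F w‖ₑ ≤ 1 := by
    rw [hφ, ← hqt1]
    refine lintegral_mono fun w => ?_
    rw [← ofReal_norm, ← ofReal_norm, ← ENNReal.ofReal_mul (by positivity)]
    refine ENNReal.ofReal_le_ofReal ?_
    rw [hF, norm_div, norm_pow]
    rw [mul_div_assoc']
    exact div_le_of_le_mul₀ (by positivity) (by positivity) (by rw [mul_comm])
  have hle : ∀ z, (‖q z‖₊ : ENNReal) ≤ ∑' w : g ⁻¹' {z}, ‖F w‖ₑ := by
    intro z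
    rw [hq z]
    exact enorm_tsum_le_tsum_enorm
  by_contra! hcon
  have hae : (fun z => (‖q z‖₊ : ENNReal)) =ᵐ[volume] fun z => ∑' w : g ⁻¹' {z}, ‖F w‖ₑ :=
    ae_eq_of_ae_le_of_lintegral_le (Filter.Eventually.of_forall hle)
      (((lintegral_mono hle).trans hφ1).trans_lt ENNReal.one_lt_top).ne hφm.aemeasurable
      (hφ1.trans hcon)
  have hpair : ∀ᵐ z, ∀ w v : ℂ, g w = z → g v = z → w ≠ v → ‖F w + F v‖ = ‖F w‖ + ‖F v‖ := by
    filter_upwards [hae, hsum] with z hz hsz w v hw hv hwv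
    refine norm_add_eq_of_norm_tsum_eq (f := fun w : g ⁻¹' {z} => F w) (i := ⟨w, hw⟩)
      (j := ⟨v, hv⟩) hsz ?_ (fun h => hwv (congrArg Subtype.val h))
    rw [← ENNReal.ofReal_eq_ofReal_iff (norm_nonneg _) (tsum_nonneg fun _ => norm_nonneg _),
      ENNReal.ofReal_tsum_of_nonneg (fun _ => norm_nonneg _) hsz]
    simp_rw [ofReal_norm]
    rw [← hz, hq z]
    rfl
  obtain ⟨Z, hZsub, hZm, hZ0⟩ := exists_measurable_superset_of_null (ae_iff.1 hpair)
  have hcrit : ∀ᵐ w, g' w ≠ 0 := by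
    have : {w | g' w = 0}.Countable := by
      have h0 : {u : ℂ | Complex.cos u = 0}.Countable := by
        refine (Set.countable_range fun k : ℤ => (2 * (k : ℂ) + 1) * Real.pi / 2).mono ?_
        intro u hu
        obtain ⟨k, hk⟩ := Complex.cos_eq_zero_iff.1 hu
        exact ⟨k, hk.symm⟩
      refine (h0.preimage_of_injOn (f := fun w => b * w + c) ?_).mono ?_
      · intro w _ v _ h
        simpa [hb] using h
      · intro w hw
        simpa [hg', ha, hb] using hw
    simpa [ae_iff] using this.measure_zero volume
  have hgZ : ∀ᵐ w, g w ∉ Z := by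
    have hgm : Measurable g := (continuous_iff_continuousAt.2 fun w =>
      (hderiv w).continuousAt).measurable
    obtain ⟨-, hI⟩ := lintegral_tsum_fiber hderiv hκ hinj
      (f := (g ⁻¹' Z).indicator fun _ => 1) (measurable_const.indicator (hgm hZm))
    have h0 : ∫⁻ z, ∑' w : g ⁻¹' {z}, (g ⁻¹' Z).indicator (fun _ => (1 : ENNReal)) w = 0 := by
      rw [← lintegral_zero]
      refine lintegral_congr_ae ?_
      filter_upwards [measure_eq_zero_iff_ae_notMem.1 hZ0] with z hz
      rw [ENNReal.tsum_eq_zero]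
      rintro ⟨w, rfl⟩
      exact Set.indicator_of_notMem (s := g ⁻¹' Z) hz _
    rw [h0] at hI
    have hz := (lintegral_eq_zero_iff (((hg'm.norm.pow_const 2).ennreal_ofReal).mul
      (measurable_const.indicator (hgm hZm)))).1 hI.symm
    filter_upwards [hz, hcrit] with w hw hw0 hwZ
    rw [Pi.zero_apply, Pi.mul_apply, Set.indicator_of_mem (s := g ⁻¹' Z) hwZ, mul_one, ENNReal.ofReal_eq_zero] at hw
    have : 0 < ‖g' w‖ ^ 2 := by positivity
    linarith
  set T : ℂ := 2 * Real.pi / b with hT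
  have hT0 : T ≠ 0 := div_ne_zero (by simp [Real.pi_ne_zero]) hb
  have hbT : ∀ w, b * (w + T) + c = b * w + c + 2 * Real.pi := by
    intro w
    rw [hT]
    field_simp
    ring
  have hgT : ∀ w, g (w + T) = g w := by
    intro w
    rw [hg, hg, hbT, Complex.sin_add_two_pi]
  have hg'T : ∀ w, g' (w + T) = g' w := by
    intro w
    simp only [hg']
    rw [hbT, Complex.cos_add_two_pi]
  have hray : ∀ᵐ w, ‖qt w + qt (w + T)‖ = ‖qt w‖ + ‖qt (w + T)‖ := by
    filter_upwards [hgZ, hcrit] with w hw hw0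
    have h2 := not_not.1 (fun h => hw (hZsub h)) w (w + T) rfl (hgT w) (by simpa using hT0)
    simp only [hF, hg'T] at h2
    rw [← add_div, norm_div, norm_div, norm_div, ← add_div] at h2
    exact (div_left_inj' (by simpa using hw0)).1 h2
  have hcount : (S ∪ (fun w => w + T) ⁻¹' S).Finite :=
    hS.union (hS.preimage (add_left_injective T).injOn)
  set U : Set ℂ := (S ∪ (fun w => w + T) ⁻¹' S)ᶜ with hU
  have hUo : IsOpen U := hcount.isClosed.isOpen_compl
  have hUc : IsPreconnected U := (hcount.countable.isConnected_compl_of_one_lt_rank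
    (by rw [Complex.rank_real_complex]; norm_num)).isPreconnected
  have hUae : ∀ᵐ w, w ∈ U := measure_eq_zero_iff_ae_notMem.1 (hcount.measure_zero volume)
  have hp : DifferentiableOn ℂ qt U := fun w hw =>
    (hqt w fun h => hw (Or.inl h)).differentiableWithinAt
  have hr : DifferentiableOn ℂ (fun w => qt (w + T)) U := fun w hw =>
    (DifferentiableAt.comp w (hqt (w + T) fun h => hw (Or.inr h))
      (differentiableAt_id.add_const T)).differentiableWithinAt
  have hrayU := Measure.eqOn_open_of_ae_eq (ae_restrict_of_ae hray) hUo
    (hp.continuousOn.add hr.continuousOn).norm (hp.continuousOn.norm.add hr.continuousOn.norm)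
  obtain ⟨w₀, hw₀, hw₀U⟩ : ∃ w₀, qt w₀ ≠ 0 ∧ w₀ ∈ U := by
    by_contra! hall
    have : ∫⁻ w, ‖qt w‖ₑ = 0 := by
      rw [← lintegral_zero]
      refine lintegral_congr_ae ?_
      filter_upwards [hUae] with w hw
      rw [not_imp_not.1 (hall w) hw, enorm_zero]
    simp [this] at hqt1
  obtain ⟨l, hl⟩ := exists_eq_const_mul_of_sameRay hUo hUc hp hr
    (fun w hw => sameRay_iff_norm_add.2 (hrayU hw)) hw₀U hw₀
  have hl1 : ‖l‖ₑ = 1 := by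
    have h1 : ∫⁻ w, ‖qt (w + T)‖ₑ = 1 := by
      rw [← hqt1]
      exact lintegral_add_right_eq_self (fun w => ‖qt w‖ₑ) T
    have h2 : ∫⁻ w, ‖qt (w + T)‖ₑ = ∫⁻ w, ‖l‖ₑ * ‖qt w‖ₑ := by
      refine lintegral_congr_ae ?_
      filter_upwards [hUae] with w hw
      rw [hl w hw, enorm_mul]
    rwa [h1, lintegral_const_mul _ hqm.enorm, hqt1, mul_one, eq_comm] at h2
  have hper : ∀ᵐ w, ‖qt (w + T)‖ₑ = ‖qt w‖ₑ := by
    filter_upwards [hUae] with w hw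
    rw [hl w hw, enorm_mul, hl1, one_mul]
  rcases lintegral_eq_zero_or_top_of_periodic (f := fun w => ‖qt w‖ₑ) hT0 hper with h | h <;> simp [h] at hqt1
end

section
/- Let R > 0 and let q : ℂ → ℂ be holomorphic on {w ∈ ℂ : |w| > R} and integrable on {w ∈ ℂ : |w| > R} with respect to Lebesgue measure. Then w²·q(w) → 0 as |w| → ∞. (Equivalently, in the Laurent expansion of q at infinity all coefficients of w^(−n) with n ≤ 2 vanish, so that q(w) = α/w^k + o(|w|^(−k)) for some k ≥ 3 unless q vanishes identically near infinity.) -/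
open MeasureTheory Complex Filter

/-- The norm of the value of a holomorphic function at the centre of a circle is at most its mean
over the circle, in polar coordinates. -/
theorem two_pi_mul_enorm_le_lintegral_circle {f : ℂ → ℂ} {c : ℂ} {r s : ℝ} (hs : 0 < s)
    (hsr : s < r) (hf : DifferentiableOn ℂ f (Metric.ball c r)) :
    ENNReal.ofReal (2 * Real.pi) * ‖f c‖ₑ ≤
      ∫⁻ θ in Set.Ioo (-Real.pi) Real.pi, ‖f (c + Complex.polarCoord.symm (s, θ))‖ₑ := by
  have hd : DiffContOnCl ℂ f (Metric.ball c |s|) := by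
    rw [abs_of_pos hs]
    exact (hf.mono (Metric.closedBall_subset_ball hsr)).diffContOnCl_ball subset_rfl
  have hmap : ∀ θ, circleMap c s θ = c + Complex.polarCoord.symm (s, θ) := by
    intro θ
    simp [circleMap, Complex.exp_mul_I]
  have hmean := hd.circleAverage
  rw [Real.circleAverage_eq_integral_add (-Real.pi),
    intervalIntegral.integral_comp_add_right (fun θ => f (circleMap c s θ)),
    show 0 + -Real.pi = -Real.pi by ring, show 2 * Real.pi + -Real.pi = Real.pi by ring,
    intervalIntegral.integral_of_le (by linarith [Real.pi_pos]), integral_Ioc_eq_integral_Ioo,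
    inv_smul_eq_iff₀ Real.two_pi_pos.ne'] at hmean
  rw [← Real.enorm_of_nonneg Real.two_pi_pos.le, ← enorm_smul, ← hmean]
  simpa only [hmap] using enorm_integral_le_lintegral_enorm (fun θ => f (circleMap c s θ))

/-- The submean value property of the norm of a holomorphic function over a disc. -/
theorem pi_mul_sq_mul_enorm_le_lintegral_ball {f : ℂ → ℂ} {c : ℂ} {r : ℝ} (hr : 0 ≤ r)
    (hf : DifferentiableOn ℂ f (Metric.ball c r)) :
    ENNReal.ofReal (Real.pi * r ^ 2) * ‖f c‖ₑ ≤ ∫⁻ z in Metric.ball c r, ‖f z‖ₑ := by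
  have hmeas : Measurable ((Metric.ball c r).indicator fun z => ‖f z‖ₑ) := by
    classical
    rw [← Set.piecewise_eq_indicator]
    exact hf.continuousOn.enorm.measurable_piecewise continuousOn_const measurableSet_ball
  rw [← lintegral_indicator measurableSet_ball, ← lintegral_add_left_eq_self _ c,
    ← Complex.lintegral_comp_polarCoord_symm, polarCoord_target, Measure.volume_eq_prod,
    ← Measure.prod_restrict, lintegral_prod]
  rotate_left
  · have hpolar : Continuous fun p : ℝ × ℝ => Complex.polarCoord.symm p := by
      simp only [Complex.polarCoord_symm_apply]
      fun_prop
    exact ((ENNReal.measurable_ofReal.comp measurable_fst).mul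
      (hmeas.comp (continuous_const.add hpolar).measurable)).aemeasurable
  have hradial : ∫⁻ s in Set.Ioo 0 r, ENNReal.ofReal s = ENNReal.ofReal (r ^ 2 / 2) := by
    have hint : IntegrableOn (fun s : ℝ => s) (Set.Ioo 0 r) :=
      (continuous_id.integrableOn_Icc).mono_set Set.Ioo_subset_Icc_self
    rw [← ofReal_integral_eq_lintegral_ofReal hint
      (ae_restrict_of_forall_mem measurableSet_Ioo fun s hs => hs.1.le),
      ← integral_Ioc_eq_integral_Ioo, ← intervalIntegral.integral_of_le hr, integral_id]
    simp
  calc ENNReal.ofReal (Real.pi * r ^ 2) * ‖f c‖ₑ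
      = ∫⁻ s in Set.Ioo 0 r, ENNReal.ofReal s * (ENNReal.ofReal (2 * Real.pi) * ‖f c‖ₑ) := by
        rw [lintegral_mul_const _ ENNReal.measurable_ofReal, hradial, ← mul_assoc,
          ← ENNReal.ofReal_mul (by positivity)]
        ring_nf
    _ ≤ ∫⁻ s in Set.Ioo 0 r, _ := by
        refine setLIntegral_mono' measurableSet_Ioo fun s hs => ?_
        refine (mul_le_mul_right (two_pi_mul_enorm_le_lintegral_circle hs.1 hs.2 hf) _).trans ?_
        rw [← lintegral_const_mul' _ _ ENNReal.ofReal_ne_top]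
        refine (lintegral_congr fun θ => ?_).le
        rw [Set.indicator_of_mem]
        · rfl
        · rw [mem_ball_iff_norm, add_sub_cancel_left, Complex.norm_polarCoord_symm,
            abs_of_pos hs.1]
          exact hs.2
    _ ≤ _ := lintegral_mono_set Set.Ioo_subset_Ioi_self

/-- The submean value property over a disc, for an integrable holomorphic function. -/
theorem pi_mul_sq_mul_norm_le_integral_ball {f : ℂ → ℂ} {c : ℂ} {r : ℝ} (hr : 0 ≤ r)
    (hf : DifferentiableOn ℂ f (Metric.ball c r)) (hint : IntegrableOn f (Metric.ball c r)) :
    Real.pi * r ^ 2 * ‖f c‖ ≤ ∫ z in Metric.ball c r, ‖f z‖ := by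
  rw [← ENNReal.ofReal_le_ofReal_iff (integral_nonneg fun _ => norm_nonneg _),
    ofReal_integral_norm_eq_lintegral_enorm hint, ENNReal.ofReal_mul (by positivity),
    ofReal_norm]
  exact pi_mul_sq_mul_enorm_le_lintegral_ball hr hf

/-- The integral of an integrable function over the complement of a large disc tends to zero. -/
theorem tendsto_integral_norm_gt_zero {E : Type*} [NormedAddCommGroup E] [NormedSpace ℝ E]
    {f : ℂ → E} {R : ℝ} (hint : IntegrableOn f {z : ℂ | R < ‖z‖}) :
    Tendsto (fun t : ℝ => ∫ z in {z : ℂ | t < ‖z‖}, f z) atTop (nhds 0) := by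
  have h := tendsto_setIntegral_of_antitone (f := f) (s := fun t : ℝ => {z : ℂ | t < ‖z‖})
    (fun t => measurableSet_lt measurable_const measurable_norm)
    (fun _ _ hst _ hz => lt_of_le_of_lt hst hz) ⟨R, hint⟩
  have hempty : ⋂ t : ℝ, {z : ℂ | t < ‖z‖} = ∅ :=
    Set.eq_empty_of_forall_notMem fun z hz => lt_irrefl ‖z‖ (Set.mem_iInter.1 hz ‖z‖)
  rwa [hempty, setIntegral_empty] at h

/-- If `q` is holomorphic and integrable on a neighborhood of infinity `{|w| > R}`,
then `w²·q(w) → 0` as `|w| → ∞`. -/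
theorem integrable_holomorphic_decay_at_infinity (R : ℝ) (hR : 0 < R)
    (q : ℂ → ℂ)
    (hq : ∀ w : ℂ, R < ‖w‖ → DifferentiableAt ℂ q w)
    (hint : IntegrableOn q {w : ℂ | R < ‖w‖}) :
    Tendsto (fun w : ℂ => w ^ 2 * q w) (Bornology.cobounded ℂ) (nhds 0) := by
  have htail : Tendsto (fun w : ℂ => 4 / Real.pi * ∫ z in {z : ℂ | ‖w‖ / 2 < ‖z‖}, ‖q z‖)
      (Bornology.cobounded ℂ) (nhds 0) := by
    have h := ((tendsto_integral_norm_gt_zero hint.norm).comp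
      ((tendsto_norm_cobounded_atTop (E := ℂ)).atTop_div_const (two_pos : (0 : ℝ) < 2))).const_mul
      (4 / Real.pi)
    rwa [mul_zero] at h
  refine squeeze_zero_norm' ?_ htail
  filter_upwards [(tendsto_norm_cobounded_atTop (E := ℂ)).eventually_ge_atTop (2 * R)] with w hw
  have hsub : {z : ℂ | ‖w‖ / 2 < ‖z‖} ⊆ {z : ℂ | R < ‖z‖} := fun z hz =>
    lt_of_le_of_lt (show R ≤ ‖w‖ / 2 by linarith) hz
  have hball : Metric.ball w (‖w‖ / 2) ⊆ {z : ℂ | ‖w‖ / 2 < ‖z‖} := fun z hz => by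
    have h := mem_ball_iff_norm'.1 hz
    have := norm_sub_norm_le w z
    simp only [Set.mem_ofPred_eq]
    linarith
  have hmean := pi_mul_sq_mul_norm_le_integral_ball (by positivity)
    (fun z hz => (hq z (hsub (hball hz))).differentiableWithinAt)
    (hint.mono_set (hball.trans hsub))
  have hmono := setIntegral_mono_set (hint.mono_set hsub).norm
    (ae_of_all _ fun z => norm_nonneg (q z)) hball.eventuallyLE
  rw [norm_mul, norm_pow, div_mul_eq_mul_div, le_div_iff₀ Real.pi_pos]
  linarith
end

section
/- Let z₀ ∈ ℂ, r > 0, and let q : ℂ → ℂ be holomorphic on the punctured disk B(z₀, r) \ {z₀} and integrable on B(z₀, r) with respect to Lebesgue measure. Then (z − z₀)²·q(z) → 0 as z → z₀ with z ≠ z₀; in particular, the isolated singularity of q at z₀ is at worst a simple pole. -/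
open MeasureTheory Complex Filter

/-- Area sub-mean value inequality for the norm of a holomorphic function on an open disk. -/
theorem DifferentiableOn.enorm_mul_volume_ball_le_lintegral {E : Type*} [NormedAddCommGroup E]
    [NormedSpace ℂ E] [CompleteSpace E] {f : ℂ → E} {c : ℂ} {R : ℝ}
    (hf : DifferentiableOn ℂ f (Metric.ball c R)) :
    ‖f c‖ₑ * volume (Metric.ball c R) ≤ ∫⁻ w in Metric.ball c R, ‖f w‖ₑ := by
  rcases le_or_gt R 0 with hR | hR
  · simp [Metric.ball_eq_empty.2 hR]
  have mean : ∀ s ∈ Set.Ioo 0 R, ENNReal.ofReal (2 * Real.pi) * ‖f c‖ₑ ≤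
      ∫⁻ θ in Set.Ioo (-Real.pi) Real.pi, ‖f (circleMap c s θ)‖ₑ := by
    intro s hs
    have hd : DiffContOnCl ℂ f (Metric.ball c |s|) := by
      apply DifferentiableOn.diffContOnCl
      rw [abs_of_pos hs.1]
      exact hf.mono ((Metric.closure_ball_subset_closedBall).trans
        (Metric.closedBall_subset_ball hs.2))
    have h1 := hd.circleAverage
    rw [Real.circleAverage_eq_integral_add (-Real.pi)] at h1
    rw [intervalIntegral.integral_comp_add_right (fun θ => f (circleMap c s θ))] at h1
    have e1 : 0 + -Real.pi = -Real.pi := by ring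
    have e2 : 2 * Real.pi + -Real.pi = Real.pi := by ring
    rw [e1, e2, intervalIntegral.integral_of_le (by linarith [Real.pi_pos]),
      integral_Ioc_eq_integral_Ioo] at h1
    have hpi : 0 < 2 * Real.pi := by positivity
    have h2 : ∫ θ in Set.Ioo (-Real.pi) Real.pi, f (circleMap c s θ) = (2 * Real.pi) • f c := by
      rw [← h1, smul_inv_smul₀ hpi.ne']
    calc _ = ‖(2 * Real.pi) • f c‖ₑ := by
          rw [enorm_smul, Real.enorm_of_nonneg hpi.le]
      _ ≤ _ := by rw [← h2]; exact enorm_integral_le_lintegral_enorm _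
  have hvol : volume (Metric.ball c R) =
      ENNReal.ofReal (2 * Real.pi) * ∫⁻ s in Set.Ioo 0 R, ENNReal.ofReal s := by
    have h0 : ∫ s in Set.Ioo 0 R, s = R ^ 2 / 2 := by
      rw [← integral_Ioc_eq_integral_Ioo, ← intervalIntegral.integral_of_le hR.le, integral_id]
      ring
    rw [← ofReal_integral_eq_lintegral_ofReal, h0, ← ENNReal.ofReal_mul (by positivity),
      Complex.volume_ball, ← ENNReal.ofReal_pow hR.le, ← ENNReal.ofReal_coe_nnreal,
      ← ENNReal.ofReal_mul (by positivity)]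
    · congr 1
      simp only [NNReal.coe_real_pi]
      ring
    · exact (continuous_id.integrableOn_Icc (a := 0) (b := R)).mono_set Set.Ioo_subset_Icc_self
    · exact (ae_restrict_mem measurableSet_Ioo).mono fun s hs => hs.1.le
  set S : Set (ℝ × ℝ) := Set.Ioo 0 R ×ˢ Set.Ioo (-Real.pi) Real.pi
  have hSm : MeasurableSet S := measurableSet_Ioo.prod measurableSet_Ioo
  have hcm : Continuous fun p : ℝ × ℝ => circleMap c p.1 p.2 := by
    unfold circleMap; fun_prop
  have hmaps : ∀ p ∈ S, circleMap c p.1 p.2 ∈ Metric.ball c R := by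
    rintro ⟨s, θ⟩ ⟨hs, -⟩
    simpa [Metric.mem_ball, dist_eq_norm, circleMap, abs_of_pos hs.1] using hs.2
  have hmeas : AEMeasurable (fun p : ℝ × ℝ => ENNReal.ofReal p.1 * ‖f (circleMap c p.1 p.2)‖ₑ)
      ((volume.restrict (Set.Ioo 0 R)).prod
        (volume.restrict (Set.Ioo (-Real.pi) Real.pi))) := by
    rw [Measure.prod_restrict]
    refine (ENNReal.measurable_ofReal.comp measurable_fst).aemeasurable.mul ?_
    exact (continuous_enorm.comp_continuousOn
      (hf.continuousOn.comp hcm.continuousOn hmaps)).aemeasurable hSm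
  calc ‖f c‖ₑ * volume (Metric.ball c R)
      = ∫⁻ s in Set.Ioo 0 R, ENNReal.ofReal s * (ENNReal.ofReal (2 * Real.pi) * ‖f c‖ₑ) := by
        rw [hvol, lintegral_mul_const _ ENNReal.measurable_ofReal]
        ring
    _ ≤ ∫⁻ s in Set.Ioo 0 R, ∫⁻ θ in Set.Ioo (-Real.pi) Real.pi,
          ENNReal.ofReal s * ‖f (circleMap c s θ)‖ₑ := by
        refine setLIntegral_mono' measurableSet_Ioo fun s hs => ?_
        rw [lintegral_const_mul' _ _ ENNReal.ofReal_ne_top]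
        gcongr
        exact mean s hs
    _ = ∫⁻ p in S, ENNReal.ofReal p.1 * ‖f (circleMap c p.1 p.2)‖ₑ := by
        rw [← lintegral_prod _ hmeas, Measure.prod_restrict, ← Measure.volume_eq_prod]
    _ ≤ ∫⁻ p in polarCoord.target, ENNReal.ofReal p.1 •
          (Metric.ball c R).indicator (fun w => ‖f w‖ₑ) (c + Complex.polarCoord.symm p) := by
        have hsub : S ⊆ polarCoord.target :=
          Set.prod_mono Set.Ioo_subset_Ioi_self subset_rfl
        refine le_trans (setLIntegral_mono' hSm fun p hp => ?_) (lintegral_mono_set hsub)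
        have e : c + Complex.polarCoord.symm p = circleMap c p.1 p.2 := by
          rw [Complex.polarCoord_symm_apply, circleMap, Complex.exp_mul_I]
          push_cast
          rfl
        rw [e, Set.indicator_of_mem (hmaps p hp), smul_eq_mul]
    _ = ∫⁻ w in Metric.ball c R, ‖f w‖ₑ := by
        rw [Complex.lintegral_comp_polarCoord_symm
            (fun w => (Metric.ball c R).indicator (fun w => ‖f w‖ₑ) (c + w)),
          lintegral_add_left_eq_self, lintegral_indicator measurableSet_ball]

/-- If `q` is holomorphic on a punctured disk around `z₀` and integrable on the disk,
then `(z − z₀)²·q(z) → 0` as `z → z₀`; in particular the singularity at `z₀` is at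
worst a simple pole. -/
theorem integrable_holomorphic_simple_pole (z₀ : ℂ) (r : ℝ) (hr : 0 < r)
    (q : ℂ → ℂ)
    (hq : ∀ z ∈ Metric.ball z₀ r \ {z₀}, DifferentiableAt ℂ q z)
    (hint : IntegrableOn q (Metric.ball z₀ r)) :
    Tendsto (fun z : ℂ => (z - z₀) ^ 2 * q z) (nhdsWithin z₀ {z₀}ᶜ) (nhds 0) := by
  have hlim : Tendsto (fun z : ℂ => ∫⁻ w in Metric.ball z₀ (2 * dist z z₀),
      ‖q w‖ₑ ∂(volume.restrict (Metric.ball z₀ r))) (nhdsWithin z₀ {z₀}ᶜ) (nhds 0) := by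
    refine tendsto_setLIntegral_zero hint.2.ne ?_
    have hcont : Tendsto (fun z : ℂ => ENNReal.ofReal (2 * dist z z₀) ^ 2 * NNReal.pi)
        (nhdsWithin z₀ {z₀}ᶜ) (nhds 0) := by
      have : Continuous fun z : ℂ => ENNReal.ofReal ((2 * dist z z₀) ^ 2 * Real.pi) :=
        ENNReal.continuous_ofReal.comp (by fun_prop)
      have h := (this.tendsto z₀).mono_left (nhdsWithin_le_nhds (s := {z₀}ᶜ))
      simp only [dist_self, mul_zero, ne_eq, OfNat.ofNat_ne_zero, not_false_eq_true, zero_pow,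
        zero_mul, ENNReal.ofReal_zero] at h
      refine h.congr fun z => ?_
      rw [ENNReal.ofReal_mul (by positivity), ENNReal.ofReal_pow (by positivity),
        ← NNReal.coe_real_pi, ENNReal.ofReal_coe_nnreal]
    refine tendsto_of_tendsto_of_tendsto_of_le_of_le tendsto_const_nhds hcont
      (fun _ => zero_le) fun z => ?_
    exact (Measure.restrict_apply_le _ _).trans (Complex.volume_ball _ _).le
  rw [tendsto_zero_iff_enorm_tendsto_zero]
  refine tendsto_of_tendsto_of_tendsto_of_le_of_le' tendsto_const_nhds hlim
    (Eventually.of_forall fun _ => zero_le) ?_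
  filter_upwards [nhdsWithin_le_nhds (Metric.ball_mem_nhds z₀ (half_pos hr))] with z hz
  rw [Metric.mem_ball] at hz
  have hd : Metric.ball z (dist z z₀) ⊆ Metric.ball z₀ (2 * dist z z₀) :=
    Metric.ball_subset_ball' (by linarith)
  have hd' : Metric.ball z₀ (2 * dist z z₀) ⊆ Metric.ball z₀ r :=
    Metric.ball_subset_ball (by linarith)
  have hdiff : DifferentiableOn ℂ q (Metric.ball z (dist z z₀)) := by
    intro w hw
    refine (hq w ⟨hd' (hd hw), ?_⟩).differentiableWithinAt
    rintro rfl
    rw [Metric.mem_ball, dist_comm] at hw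
    exact lt_irrefl _ hw
  calc ‖(z - z₀) ^ 2 * q z‖ₑ = ‖q z‖ₑ * (ENNReal.ofReal (dist z z₀) ^ 2 * 1) := by
        rw [enorm_mul, enorm_pow, dist_eq_norm, ofReal_norm, mul_one, mul_comm]
    _ ≤ ‖q z‖ₑ * (ENNReal.ofReal (dist z z₀) ^ 2 * NNReal.pi) := by
        gcongr
        have : (1 : NNReal) ≤ NNReal.pi := by
          rw [← NNReal.coe_le_coe, NNReal.coe_real_pi, NNReal.coe_one]
          linarith [Real.pi_gt_three]
        exact_mod_cast this
    _ = ‖q z‖ₑ * volume (Metric.ball z (dist z z₀)) := by rw [Complex.volume_ball]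
    _ ≤ ∫⁻ w in Metric.ball z (dist z z₀), ‖q w‖ₑ :=
        hdiff.enorm_mul_volume_ball_le_lintegral
    _ ≤ ∫⁻ w in Metric.ball z₀ (2 * dist z z₀), ‖q w‖ₑ := lintegral_mono_set hd
    _ = _ := by
        rw [Measure.restrict_restrict measurableSet_ball, Set.inter_eq_left.2 hd']
end

section
/- Let λ ∈ ℂ with λ ≠ 0 and g(w) = λ·sin w. Let S ⊂ ℂ be a finite set and let q̃ : ℂ → ℂ be holomorphic on ℂ \ S and integrable on ℂ with respect to Lebesgue measure. Then for every z ∈ ℂ \ ({λ, −λ} ∪ g(S)), the family (q̃(w)/(g'(w))²) indexed by w ∈ g⁻¹(z) is absolutely summable, and the push-forward q(z) = ∑_{w ∈ g⁻¹(z)} q̃(w)/(g'(w))² defines a function holomorphic on the open set ℂ \ ({λ, −λ} ∪ g(S)). -/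
open MeasureTheory Complex

theorem two_pi_mul_enorm_le_lintegral_circleMap {f : ℂ → ℂ} {c : ℂ} {r ρ : ℝ}
    (hf : DifferentiableOn ℂ f (Metric.ball c r)) (h0 : 0 < ρ) (hr : ρ < r) :
    ENNReal.ofReal (2 * Real.pi) * ‖f c‖ₑ ≤
      ∫⁻ θ in Set.Ioo (-Real.pi) Real.pi, ‖f (circleMap c ρ θ)‖ₑ := by
  have hd : DiffContOnCl ℂ f (Metric.ball c |ρ|) := by
    rw [abs_of_pos h0]
    exact (hf.mono (Metric.closedBall_subset_ball hr)).diffContOnCl_ball subset_rfl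
  have h := hd.circleAverage
  rw [Real.circleAverage_eq_integral_add (-Real.pi),
    intervalIntegral.integral_comp_add_right (fun θ => f (circleMap c ρ θ)),
    inv_smul_eq_iff₀ Real.two_pi_pos.ne'] at h
  have hlim : 2 * Real.pi + -Real.pi = Real.pi := by ring
  rw [zero_add, hlim, intervalIntegral.integral_of_le (by linarith [Real.pi_pos]),
    integral_Ioc_eq_integral_Ioo] at h
  rw [← Real.enorm_of_nonneg Real.two_pi_pos.le, ← enorm_smul, ← h]
  exact enorm_integral_le_lintegral_enorm _

theorem enorm_mul_le_setLIntegral_ball {f : ℂ → ℂ} {c : ℂ} {r : ℝ}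
    (hf : DifferentiableOn ℂ f (Metric.ball c r)) :
    ‖f c‖ₑ * volume (Metric.ball c r) ≤ ∫⁻ x in Metric.ball c r, ‖f x‖ₑ := by
  have hpolar : ∀ F : ℂ → ENNReal, ∫⁻ x in Metric.ball c r, F x =
      ∫⁻ p in Set.Ioo 0 r ×ˢ Set.Ioo (-Real.pi) Real.pi,
        ENNReal.ofReal p.1 * F (circleMap c p.1 p.2) := by
    intro F
    have hset : Set.Ioo 0 r ×ˢ Set.Ioo (-Real.pi) Real.pi =
        {p : ℝ × ℝ | p.1 < r} ∩ Complex.polarCoord.target := by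
      ext p
      simp only [Complex.polarCoord_target, Set.mem_prod, Set.mem_Ioo, Set.mem_inter_iff,
        Set.mem_ofPred_eq, Set.mem_Ioi]
      tauto
    rw [← lintegral_indicator Metric.isOpen_ball.measurableSet,
      ← lintegral_add_left_eq_self _ c, ← Complex.lintegral_comp_polarCoord_symm, hset,
      ← Measure.restrict_restrict (measurableSet_lt measurable_fst measurable_const),
      ← lintegral_indicator (measurableSet_lt measurable_fst measurable_const)]
    refine setLIntegral_congr_fun Complex.polarCoord.open_target.measurableSet fun p hp => ?_
    have hp0 : 0 < p.1 := hp.1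
    have hmap : c + Complex.polarCoord.symm p = circleMap c p.1 p.2 := by
      simp [circleMap, Complex.exp_mul_I]
    have hmem : circleMap c p.1 p.2 ∈ Metric.ball c r ↔ p.1 < r := by
      simp [circleMap, abs_of_pos hp0]
    rw [hmap]
    by_cases h : p.1 < r
    · simp [Set.indicator, h, hmem.2 h]
    · simp [Set.indicator, h, mt hmem.1 h]
  have hcont : ContinuousOn (fun p : ℝ × ℝ => f (circleMap c p.1 p.2))
      (Set.Ioo 0 r ×ˢ Set.Ioo (-Real.pi) Real.pi) := by
    refine hf.continuousOn.comp (by unfold circleMap; fun_prop) fun p hp => ?_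
    simp [circleMap, abs_of_pos hp.1.1, hp.1.2]
  have hmeas : MeasurableSet (Set.Ioo 0 r ×ˢ Set.Ioo (-Real.pi) Real.pi) :=
    measurableSet_Ioo.prod measurableSet_Ioo
  rw [← setLIntegral_const, hpolar, hpolar, Measure.volume_eq_prod, ← Measure.prod_restrict,
    lintegral_prod _ (by fun_prop), lintegral_prod]
  · refine setLIntegral_mono' measurableSet_Ioo fun ρ hρ => ?_
    dsimp only
    rw [setLIntegral_const, lintegral_const_mul' _ _ ENNReal.ofReal_ne_top, Real.volume_Ioo,
      mul_assoc]
    gcongr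
    convert! two_pi_mul_enorm_le_lintegral_circleMap hf hρ.1 hρ.2 using 1
    rw [mul_comm]
    congr 2
    ring
  · rw [Measure.prod_restrict, ← Measure.volume_eq_prod]
    exact AEMeasurable.mul (by fun_prop) (hcont.aemeasurable hmeas).enorm

/-- An integrable function holomorphic on pairwise disjoint discs is bounded, uniformly on the
concentric discs of half the radius, by a summable family. -/
theorem exists_summable_bound_translates {ι : Type*} [Countable ι] {f : ℂ → ℂ}
    (hint : Integrable f) {a : ι → ℂ} {c : ℂ} {r : ℝ} (hr : 0 < r)
    (hdisj : Pairwise fun i j => Disjoint (Metric.ball (c + a i) (2 * r))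
      (Metric.ball (c + a j) (2 * r)))
    (hf : ∀ i, DifferentiableOn ℂ f (Metric.ball (c + a i) (2 * r))) :
    ∃ u : ι → ℝ, Summable u ∧ ∀ i, ∀ w ∈ Metric.ball c r, ‖f (w + a i)‖ ≤ u i := by
  refine ⟨fun i => (∫ x in Metric.ball (c + a i) (2 * r), ‖f x‖) / volume.real (Metric.ball c r),
    ((hasSum_integral_iUnion (fun i => Metric.isOpen_ball.measurableSet) hdisj
      hint.norm.integrableOn).summable).div_const _, fun i w hw => ?_⟩
  have hsub : Metric.ball (w + a i) r ⊆ Metric.ball (c + a i) (2 * r) := by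
    apply Metric.ball_subset_ball'
    rw [dist_add_right]
    linarith [Metric.mem_ball.1 hw]
  have h := (enorm_mul_le_setLIntegral_ball ((hf i).mono hsub)).trans (lintegral_mono_set hsub)
  rw [Complex.volume_ball] at h
  have hpos : 0 < volume.real (Metric.ball c r) :=
    ENNReal.toReal_pos (Metric.measure_ball_pos _ _ hr).ne' measure_ball_lt_top.ne
  rw [le_div_iff₀ hpos,
    integral_norm_eq_lintegral_enorm hint.1.restrict, ← toReal_enorm, measureReal_def,
    ← ENNReal.toReal_mul, Complex.volume_ball]
  exact ENNReal.toReal_mono hint.integrableOn.2.ne h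

theorem summable_and_differentiableOn_tsum_translates {f : ℂ → ℂ} (hint : Integrable f)
    {c : ℂ} {r : ℝ} (hr : 0 < r) (hrpi : 2 * r < Real.pi)
    (hf : ∀ k : ℤ, DifferentiableOn ℂ f (Metric.ball (c + 2 * k * Real.pi) (2 * r))) :
    (∀ w ∈ Metric.ball c r, Summable fun k : ℤ => ‖f (w + 2 * k * Real.pi)‖) ∧
      DifferentiableOn ℂ (fun w => ∑' k : ℤ, f (w + 2 * k * Real.pi)) (Metric.ball c r) := by
  have hdisj : Pairwise fun k l : ℤ => Disjoint (Metric.ball (c + 2 * k * Real.pi) (2 * r))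
      (Metric.ball (c + 2 * l * Real.pi) (2 * r)) := by
    intro k l hkl
    apply Metric.ball_disjoint_ball
    have h1 : (1 : ℝ) ≤ |(k : ℝ) - l| := by
      exact_mod_cast Int.one_le_abs (sub_ne_zero.2 hkl)
    have h2 : dist (c + 2 * (k : ℂ) * Real.pi) (c + 2 * (l : ℂ) * Real.pi) =
        2 * Real.pi * |(k : ℝ) - l| := by
      have h3 : 2 * (k : ℂ) * Real.pi - 2 * (l : ℂ) * Real.pi =
          ((2 * Real.pi * ((k : ℝ) - l) : ℝ) : ℂ) := by
        push_cast
        ring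
      rw [dist_add_left, dist_eq_norm, h3, Complex.norm_real, norm_mul,
        Real.norm_of_nonneg Real.two_pi_pos.le, Real.norm_eq_abs]
    rw [h2]
    nlinarith [Real.pi_pos]
  obtain ⟨u, hu, hle⟩ := exists_summable_bound_translates hint hr
    (a := fun k : ℤ => 2 * (k : ℂ) * Real.pi) hdisj hf
  refine ⟨fun w hw => hu.of_nonneg_of_le (fun _ => norm_nonneg _) fun k => hle k w hw,
    differentiableOn_tsum_of_summable_norm hu (fun k => (hf k).comp (by fun_prop) ?_)
      Metric.isOpen_ball hle⟩
  intro w hw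
  rw [Metric.mem_ball, dist_add_right]
  linarith [Metric.mem_ball.1 hw]

/-- Sums over a regular fibre of the sine split into sums over two orbits of `2πℤ`. -/
theorem hasSum_sin_fiber {M : Type*} [AddCommMonoid M] [TopologicalSpace M] [ContinuousAdd M]
    {F : ℂ → M} {A B : M} {w : ℂ} (hw : Complex.cos w ≠ 0) {T : Set ℂ}
    (hT : ∀ v, v ∈ T ↔ Complex.sin v = Complex.sin w)
    (hA : HasSum (fun k : ℤ => F (w + 2 * k * Real.pi)) A)
    (hB : HasSum (fun k : ℤ => F ((Real.pi - w) + 2 * k * Real.pi)) B) :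
    HasSum (fun v : T => F v) (A + B) := by
  have hpi : (Real.pi : ℂ) ≠ 0 := Complex.ofReal_ne_zero.2 Real.pi_ne_zero
  let e : ℤ ⊕ ℤ → T := Sum.elim
    (fun k => ⟨w + 2 * k * Real.pi,
      (hT _).2 (Complex.sin_eq_sin_iff.2 ⟨k, Or.inl (add_comm _ _)⟩).symm⟩)
    (fun k => ⟨(Real.pi - w) + 2 * k * Real.pi,
      (hT _).2 (Complex.sin_eq_sin_iff.2 ⟨k, Or.inr (by ring)⟩).symm⟩)
  have hne : ∀ k l : ℤ, w + 2 * k * Real.pi ≠ (Real.pi - w) + 2 * l * Real.pi := by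
    intro k l h
    refine hw (Complex.cos_eq_zero_iff.2 ⟨l - k, ?_⟩)
    push_cast
    linear_combination h / 2
  have he : Function.Bijective e := by
    constructor
    · rintro (k | k) (l | l) h <;> have h := congrArg Subtype.val h <;>
        simp only [e, Sum.elim_inl, Sum.elim_inr] at h
      · simpa [hpi] using h
      · exact absurd h (hne k l)
      · exact absurd h.symm (hne l k)
      · simpa [hpi] using h
    · rintro ⟨v, hv⟩
      obtain ⟨k, hk | hk⟩ := Complex.sin_eq_sin_iff.1 ((hT v).1 hv).symm
      · exact ⟨Sum.inl k, Subtype.ext (by simp only [e, Sum.elim_inl, hk]; ring)⟩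
      · exact ⟨Sum.inr k, Subtype.ext (by simp only [e, Sum.elim_inr, hk]; ring)⟩
  exact (Equiv.ofBijective e he).hasSum_iff.1 (HasSum.sum hA hB)

/-- Differentiability descends through a map with invertible derivative. -/
theorem DifferentiableAt.of_comp_hasStrictDerivAt {q g : ℂ → ℂ} {w g' : ℂ}
    (hqg : DifferentiableAt ℂ (q ∘ g) w) (hg : HasStrictDerivAt g g' w) (hg' : g' ≠ 0) :
    DifferentiableAt ℂ q (g w) := by
  have hval : hg.localInverse g g' w hg' (g w) = w :=
    HasStrictFDerivAt.localInverse_apply_image ..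
  rw [← hval] at hqg
  refine (hqg.comp (g w)
    (hg.to_localInverse hg').hasDerivAt.differentiableAt).congr_of_eventuallyEq ?_
  filter_upwards [hg.eventually_right_inverse hg'] with y hy
  simp only [Function.comp_apply, hy]

/-- For `g(w) = λ·sin w` and `q̃` holomorphic off a finite set `S` and integrable,
the push-forward series converges absolutely off the critical values `±λ` and the
images of `S`, and the push-forward `q` is holomorphic there. -/
theorem pushforward_holomorphic (lam : ℂ) (hlam : lam ≠ 0)
    (g : ℂ → ℂ) (hg : ∀ w : ℂ, g w = lam * Complex.sin w)
    (S : Set ℂ) (hS : S.Finite)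
    (qt : ℂ → ℂ) (hqt : ∀ w : ℂ, w ∉ S → DifferentiableAt ℂ qt w)
    (hint : Integrable qt)
    (q : ℂ → ℂ)
    (hq : ∀ z : ℂ, q z = ∑' w : (g ⁻¹' {z}), qt ↑w / (lam * Complex.cos ↑w) ^ 2) :
    (∀ z : ℂ, z ∉ ({lam, -lam} : Set ℂ) ∪ g '' S →
      Summable fun w : (g ⁻¹' {z}) => ‖qt ↑w / (lam * Complex.cos ↑w) ^ 2‖) ∧
    ∀ z : ℂ, z ∉ ({lam, -lam} : Set ℂ) ∪ g '' S → DifferentiableAt ℂ q z := by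
  have hpt : ∀ z : ℂ, z ∉ ({lam, -lam} : Set ℂ) ∪ g '' S →
      (Summable fun w : (g ⁻¹' {z}) => ‖qt ↑w / (lam * Complex.cos ↑w) ^ 2‖) ∧
        DifferentiableAt ℂ q z := by
    intro z hz
    obtain ⟨w₀, hw₀⟩ := Complex.sin_surjective (z / lam)
    have hgw₀ : g w₀ = z := by rw [hg, hw₀, mul_div_cancel₀ _ hlam]
    have hcos₀ : Complex.cos w₀ ≠ 0 := by
      intro h
      have h1 : Complex.sin w₀ ^ 2 = 1 := by rw [Complex.sin_sq, h]; ring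
      refine hz (Or.inl ?_)
      rw [← hgw₀, hg]
      rcases eq_or_eq_neg_of_sq_eq_sq _ (1 : ℂ) (by rw [h1, one_pow]) with h2 | h2 <;> simp [h2]
    have hgfun : g = fun w => lam * Complex.sin w := funext hg
    have hgcont : Continuous g := by rw [hgfun]; fun_prop
    have hopen : IsOpen (g ⁻¹' (g '' S)ᶜ ∩ {w | Complex.cos w ≠ 0}) :=
      ((hS.image g).isClosed.isOpen_compl.preimage hgcont).inter
        (isOpen_ne_fun Complex.continuous_cos continuous_const)
    obtain ⟨R, hR, hball⟩ := Metric.isOpen_iff.1 hopen w₀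
      ⟨fun h => hz (Or.inr (hgw₀ ▸ h)), hcos₀⟩
    obtain ⟨r, hr, hrR, hrpi⟩ : ∃ r : ℝ, 0 < r ∧ 2 * r ≤ R ∧ 2 * r < Real.pi :=
      ⟨min (R / 2) 1, by positivity, by linarith [min_le_left (R / 2) 1],
        by linarith [min_le_right (R / 2) 1, Real.pi_gt_three]⟩
    have hdiff : ∀ v w : ℂ, Complex.sin v = Complex.sin w → w ∈ Metric.ball w₀ (2 * r) →
        DifferentiableAt ℂ qt v := fun v w hvw hw =>
      hqt v fun hv => (hball (Metric.ball_subset_ball hrR hw)).1 ⟨v, hv, by rw [hg, hg, hvw]⟩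
    obtain ⟨hsumA, hdiffA⟩ := summable_and_differentiableOn_tsum_translates hint (c := w₀) hr hrpi
      fun k v hv => (hdiff v (v - 2 * k * Real.pi)
        (Complex.sin_eq_sin_iff.2 ⟨-k, Or.inl (by push_cast; ring)⟩)
        (by rw [Metric.mem_ball, dist_eq_norm] at hv ⊢; convert! hv using 2; ring)
        ).differentiableWithinAt
    obtain ⟨hsumB, hdiffB⟩ := summable_and_differentiableOn_tsum_translates hint
      (c := Real.pi - w₀) hr hrpi
      fun k v hv => (hdiff v (Real.pi - v + 2 * k * Real.pi)
        (Complex.sin_eq_sin_iff.2 ⟨k, Or.inr (by ring)⟩)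
        (by
          rw [Metric.mem_ball, dist_eq_norm] at hv ⊢
          rw [← norm_neg]
          convert! hv using 2
          ring)).differentiableWithinAt
    have hrefl : ∀ w ∈ Metric.ball w₀ r, Real.pi - w ∈ Metric.ball (Real.pi - w₀) r := by
      intro w hw
      rwa [Metric.mem_ball, dist_sub_left]
    have hfib : ∀ w v : ℂ, v ∈ g ⁻¹' {g w} ↔ Complex.sin v = Complex.sin w := by
      intro w v
      simp [hg, hlam]
    have hterm : ∀ w, ∀ v : g ⁻¹' {g w}, qt v / (lam * Complex.cos v) ^ 2 =
        qt v / (lam * Complex.cos w) ^ 2 := by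
      intro w v
      rw [mul_pow, mul_pow, Complex.cos_sq', Complex.cos_sq' w, (hfib w v).1 v.2]
    have hcos : ∀ w ∈ Metric.ball w₀ r, Complex.cos w ≠ 0 := fun w hw =>
      (hball (Metric.ball_subset_ball (by linarith) hw)).2
    have hq_comp : ∀ w ∈ Metric.ball w₀ r, q (g w) =
        (∑' k : ℤ, qt (w + 2 * k * Real.pi) +
          ∑' k : ℤ, qt ((Real.pi - w) + 2 * k * Real.pi)) / (lam * Complex.cos w) ^ 2 := by
      intro w hw
      rw [hq, tsum_congr (hterm w)]
      exact ((hasSum_sin_fiber (F := qt) (hcos w hw) (hfib w) (hsumA w hw).of_norm.hasSum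
        (hsumB _ (hrefl w hw)).of_norm.hasSum).div_const _).tsum_eq
    have hmem₀ : w₀ ∈ Metric.ball w₀ r := Metric.mem_ball_self hr
    have hqg : DifferentiableAt ℂ (q ∘ g) w₀ := by
      have hA := hdiffA.differentiableAt (Metric.isOpen_ball.mem_nhds hmem₀)
      have hB := (hdiffB.differentiableAt
        (Metric.isOpen_ball.mem_nhds (hrefl w₀ hmem₀))).comp w₀
        (differentiableAt_id.const_sub (Real.pi : ℂ))
      refine ((hA.add hB).div (by fun_prop : DifferentiableAt ℂ
        (fun w => (lam * Complex.cos w) ^ 2) w₀)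
        (pow_ne_zero 2 (mul_ne_zero hlam hcos₀))).congr_of_eventuallyEq ?_
      filter_upwards [Metric.isOpen_ball.mem_nhds hmem₀] with w hw using hq_comp w hw
    constructor
    · rw [← hgw₀]
      simp_rw [hterm w₀, norm_div]
      exact (hasSum_sin_fiber (F := fun v => ‖qt v‖) hcos₀ (hfib w₀) (hsumA w₀ hmem₀).hasSum
        (hsumB _ (hrefl w₀ hmem₀)).hasSum).summable.div_const _
    · have hderiv : HasStrictDerivAt g (lam * Complex.cos w₀) w₀ := by
        rw [hgfun]
        exact (Complex.hasStrictDerivAt_sin w₀).const_mul lam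
      rw [← hgw₀]
      exact hqg.of_comp_hasStrictDerivAt hderiv (mul_ne_zero hlam hcos₀)
  exact ⟨fun z hz => (hpt z hz).1, fun z hz => (hpt z hz).2⟩
end

section
/- Let k ≥ 2 be an integer, let r > 0, and set w = r·exp(i·(π/2)·(1 − 1/k)) ∈ ℂ. Then the real part of w equals s := r·sin(π/(2k)), and one has the cancellation identity (w − 2s)^k = −w^k; equivalently, w^(−k) = −(w − 2s)^(−k). -/
open Complex Real

/-- For `w = r·e^{iθ}` with `θ = (π/2)(1 − 1/k)`, the real part of `w` is
`s = r·sin(π/(2k))` and one has the cancellation identity `(w − 2s)^k = −w^k`. -/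
theorem rotation_cancellation (k : ℕ) (hk : 2 ≤ k) (r : ℝ) (hr : 0 < r)
    (w : ℂ)
    (hw : w = (r : ℂ) * Complex.exp (((Real.pi / 2 * (1 - 1 / (k : ℝ))) : ℂ) * Complex.I))
    (s : ℝ) (hs : s = r * Real.sin (Real.pi / (2 * (k : ℝ)))) :
    w.re = s ∧ (w - 2 * (s : ℂ)) ^ k = -(w ^ k) := by
  have hk0 : (k : ℝ) ≠ 0 := by positivity
  have hkc : (k : ℂ) ≠ 0 := by exact_mod_cast hk0
  set θ : ℝ := Real.pi / 2 * (1 - 1 / (k : ℝ)) with hθ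
  have hwθ : w = (r : ℂ) * Complex.exp ((θ : ℂ) * Complex.I) := by
    rw [hw, hθ]
    push_cast
    rfl
  have hcos : Real.cos θ = Real.sin (Real.pi / (2 * (k : ℝ))) := by
    rw [← Real.cos_pi_div_two_sub, hθ]
    congr 1
    field_simp
  have hre : w.re = s := by
    rw [hwθ, Complex.re_ofReal_mul, Complex.exp_ofReal_mul_I_re, hcos, hs]
  refine ⟨hre, ?_⟩
  have hreflect : w - 2 * (s : ℂ) = (r : ℂ) * Complex.exp (((Real.pi - θ : ℝ) : ℂ) * Complex.I) := by
    rw [hwθ, hs, ← hcos, Complex.exp_mul_I, Complex.exp_mul_I, ← Complex.ofReal_cos,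
      ← Complex.ofReal_sin, ← Complex.ofReal_cos, ← Complex.ofReal_sin, Real.cos_pi_sub,
      Real.sin_pi_sub]
    push_cast
    ring
  have hrotate : w - 2 * (s : ℂ) = w * Complex.exp (Real.pi * Complex.I / k) := by
    rw [hreflect, hwθ, mul_assoc, ← Complex.exp_add, hθ]
    congr 2
    push_cast
    field_simp
    ring
  rw [hrotate, mul_pow, ← Complex.exp_nat_mul, mul_div_cancel₀ _ hkc, Complex.exp_pi_mul_I,
    mul_neg_one]
end
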